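/- arXiv:2403.05737 — 3 statements merged into one kernel-verified Lean document; each statement's English description precedes it below -/
import Mathlib

section
/- There exist a constant c > 0 and a natural number n₀ such that for every n ≥ n₀ there exists a finite bipartite graph G with n vertices and at least c · n · log(log n) edges such that G has no nonempty subgraph in which every vertex has degree exactly 3 (and consequently no nonempty r-regular subgraph for any r ≥ 3). -/
open SimpleGraph
open scoped Classical

noncomputable section

/-- `G` is bipartite: the vertices can be partitioned into two independent sets. -/
def Bip {V : Type} (G : SimpleGraph V) : Prop :=
  ∃ A : Set V, ∀ ⦃a b : V⦄, G.Adj a b → (a ∈ A ↔ b ∉ A)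

/-- Number of functions with prescribed values on `P`. -/
lemma count_prescribed {ι : Type} [Fintype ι] (M : ι → ℕ) (P : Finset ι) (L : ℕ)
    (hL : ∀ p ∈ P, L ≤ M p) (f₀ : ∀ p, Fin (M p)) :
    (Finset.univ.filter (fun f : ∀ p, Fin (M p) => ∀ p ∈ P, f p = f₀ p)).card * L ^ P.card
      ≤ ∏ p, M p := by
  have h1 : (Finset.univ.filter (fun f : ∀ p, Fin (M p) => ∀ p ∈ P, f p = f₀ p))
      = Fintype.piFinset (fun p => if p ∈ P then {f₀ p} else Finset.univ) := by
    ext f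
    simp only [Finset.mem_filter, Finset.mem_univ, true_and, Fintype.mem_piFinset]
    refine forall_congr' fun p => ?_
    by_cases hp : p ∈ P <;> simp [hp]
  rw [h1, Fintype.card_piFinset]
  have h2 : L ^ P.card = ∏ p, (if p ∈ P then L else 1) := by
    rw [Finset.prod_ite]; simp
  rw [h2, ← Finset.prod_mul_distrib]
  apply Finset.prod_le_prod'
  intro p _
  by_cases hp : p ∈ P <;> simp [hp, hL]

/-- the bad event. -/
def Bad {a k : ℕ} (N : Fin k → ℕ) (m b : ℕ) (S : Finset (Fin k))
    (f : ∀ p : Fin a × Fin k, Fin (N p.2)) : Prop :=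
  ∃ A' : Finset (Fin a), A'.card = m ∧ ∃ B' : Finset (Σ i, Fin (N i)), B'.card = b ∧
    (∀ v ∈ B', v.1 ∈ S) ∧ ∀ v ∈ B', 3 ≤ (A'.filter (fun x => f (x, v.1) = v.2)).card

lemma count_fixed {a k : ℕ} (N : Fin k → ℕ) (b L : ℕ) (S : Finset (Fin k))
    (hL : ∀ i ∈ S, L ≤ N i) (B' : Finset (Σ i, Fin (N i))) (hb : B'.card = b)
    (hS : ∀ v ∈ B', v.1 ∈ S) (T : (Σ i, Fin (N i)) → Finset (Fin a))
    (hT : ∀ v ∈ B', (T v).card = 3) :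
    (Finset.univ.filter (fun f : ∀ p : Fin a × Fin k, Fin (N p.2) =>
      ∀ v ∈ B', ∀ x ∈ T v, f (x, v.1) = v.2)).card * L ^ (3 * b)
      ≤ ∏ p : Fin a × Fin k, N p.2 := by
  by_cases hne : ∃ f₀ : ∀ p : Fin a × Fin k, Fin (N p.2), ∀ v ∈ B', ∀ x ∈ T v, f₀ (x, v.1) = v.2
  · obtain ⟨f₀, hf₀⟩ := hne
    set Q := B'.sigma T with hQ
    set P : Finset (Fin a × Fin k) := Q.image (fun q => (q.2, q.1.1)) with hP
    have hPc : P.card = 3 * b := by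
      rw [hP, Finset.card_image_of_injOn, hQ, Finset.card_sigma, Finset.sum_congr rfl hT]
      · simp [hb, mul_comm]
      · rintro ⟨⟨i, u⟩, x⟩ h1 ⟨⟨j, w⟩, y⟩ h2 h
        simp only [hQ, Finset.coe_sigma, Set.mem_sigma_iff, Finset.mem_coe] at h1 h2
        simp only [Prod.mk.injEq] at h
        obtain ⟨rfl, rfl⟩ := h
        have e1 := hf₀ _ h1.1 _ h1.2
        have e2 := hf₀ _ h2.1 _ h2.2
        simp only at e1 e2
        rw [← e1, ← e2]
    rw [← hPc]
    refine le_trans (Nat.mul_le_mul_right _ (Finset.card_le_card ?_))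
      (count_prescribed (fun p : Fin a × Fin k => N p.2) P L ?_ f₀)
    · intro f hf
      simp only [Finset.mem_filter, Finset.mem_univ, true_and] at hf ⊢
      intro p hp
      obtain ⟨⟨v, x⟩, hq, rfl⟩ := Finset.mem_image.1 hp
      rw [hQ, Finset.mem_sigma] at hq
      exact (hf v hq.1 x hq.2).trans (hf₀ v hq.1 x hq.2).symm
    · intro p hp
      obtain ⟨⟨v, x⟩, hq, rfl⟩ := Finset.mem_image.1 hp
      rw [hQ, Finset.mem_sigma] at hq
      exact hL _ (hS _ hq.1)
  · rw [Finset.filter_false_of_mem]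
    · simp
    · intro f _ h
      exact hne ⟨f, h⟩

lemma count_bad {a k : ℕ} (N : Fin k → ℕ) (m b L : ℕ) (S : Finset (Fin k))
    (hL : ∀ i ∈ S, L ≤ N i) :
    (Finset.univ.filter (fun f : ∀ p : Fin a × Fin k, Fin (N p.2) => Bad N m b S f)).card
      * L ^ (3 * b) ≤
    a.choose m * ((∑ i, N i).choose b * ((m ^ 3) ^ b * ∏ p : Fin a × Fin k, N p.2)) := by
  set X : Finset (Finset (Fin a)) := Finset.powersetCard m Finset.univ with hX
  set Y : Finset (Finset (Σ i, Fin (N i))) :=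
    (Finset.powersetCard b Finset.univ).filter (fun B' => ∀ v ∈ B', v.1 ∈ S) with hY
  set Z : Finset (Fin a) → Finset (Σ i, Fin (N i)) →
      Finset ((Σ i, Fin (N i)) → Finset (Fin a)) := fun A' B' =>
    Fintype.piFinset (fun v => if v ∈ B' then Finset.powersetCard 3 A' else {∅}) with hZ
  have hsub : (Finset.univ.filter (fun f : ∀ p : Fin a × Fin k, Fin (N p.2) => Bad N m b S f)) ⊆
      X.biUnion (fun A' => Y.biUnion (fun B' => (Z A' B').biUnion (fun T =>
        Finset.univ.filter (fun f : ∀ p : Fin a × Fin k, Fin (N p.2) =>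
          ∀ v ∈ B', ∀ x ∈ T v, f (x, v.1) = v.2)))) := by
    intro f hf
    obtain ⟨A', hA, B', hB, hBS, h3⟩ := (Finset.mem_filter.1 hf).2
    have : ∀ v, ∃ t : Finset (Fin a), v ∈ B' →
        t ⊆ (A'.filter (fun x => f (x, v.1) = v.2)) ∧ t.card = 3 := by
      intro v
      by_cases hv : v ∈ B'
      · obtain ⟨t, h1, h2⟩ := Finset.exists_subset_card_eq (h3 v hv)
        exact ⟨t, fun _ => ⟨h1, h2⟩⟩
      · exact ⟨∅, fun h => absurd h hv⟩
    choose t ht using this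
    simp only [Finset.mem_biUnion]
    refine ⟨A', by simp [hX, hA], B', by rw [hY, Finset.mem_filter]; exact ⟨by simp [hB], hBS⟩,
      fun v => if v ∈ B' then t v else ∅, ?_, ?_⟩
    · rw [hZ, Fintype.mem_piFinset]
      intro v
      by_cases hv : v ∈ B'
      · simp only [hv, if_true, Finset.mem_powersetCard]
        exact ⟨(ht v hv).1.trans (Finset.filter_subset _ _), (ht v hv).2⟩
      · simp [hv]
    · simp only [Finset.mem_filter, Finset.mem_univ, true_and]
      intro v hv x hx
      rw [if_pos hv] at hx
      exact (Finset.mem_filter.1 ((ht v hv).1 hx)).2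
  have hXc : X.card = a.choose m := by simp [hX]
  have hYc : Y.card ≤ (∑ i, N i).choose b := by
    refine (Finset.card_filter_le _ _).trans ?_
    rw [Finset.card_powersetCard]
    simp
  refine (Nat.mul_le_mul_right _ (Finset.card_le_card hsub)).trans ?_
  refine (Nat.mul_le_mul_right _ Finset.card_biUnion_le).trans ?_
  rw [Finset.sum_mul, ← hXc, ← smul_eq_mul (a := X.card)]
  refine Finset.sum_le_card_nsmul _ _ _ fun A' hA => ?_
  refine (Nat.mul_le_mul_right _ Finset.card_biUnion_le).trans ?_
  rw [Finset.sum_mul]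
  refine le_trans ?_ (Nat.mul_le_mul_right _ hYc)
  rw [← smul_eq_mul (a := Y.card)]
  refine Finset.sum_le_card_nsmul _ _ _ fun B' hB => ?_
  have hB2 : B'.card = b ∧ ∀ v ∈ B', v.1 ∈ S := by
    rw [hY, Finset.mem_filter, Finset.mem_powersetCard] at hB
    exact ⟨hB.1.2, hB.2⟩
  have hA2 : A'.card = m := (Finset.mem_powersetCard.1 hA).2
  refine (Nat.mul_le_mul_right _ Finset.card_biUnion_le).trans ?_
  rw [Finset.sum_mul]
  have hZc : (Z A' B').card ≤ (m ^ 3) ^ b := by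
    rw [hZ, Fintype.card_piFinset]
    have : ∀ v, (if v ∈ B' then Finset.powersetCard 3 A' else {∅}).card
        = if v ∈ B' then m.choose 3 else 1 := by
      intro v; split_ifs <;> simp [hA2]
    simp only [this]
    rw [Finset.prod_ite]
    simp only [Finset.prod_const, one_pow, mul_one]
    have e : (Finset.univ.filter (fun v => v ∈ B')) = B' := by ext; simp
    rw [e, hB2.1]
    exact Nat.pow_le_pow_left (Nat.choose_le_pow m 3) b
  refine le_trans ?_ (Nat.mul_le_mul_right _ hZc)
  rw [← smul_eq_mul (a := (Z A' B').card)]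
  refine Finset.sum_le_card_nsmul _ _ _ fun T hT => ?_
  refine count_fixed N b L S hL B' hB2.1 hB2.2 T ?_
  intro v hv
  have := (Fintype.mem_piFinset.1 hT) v
  rw [if_pos hv] at this
  exact (Finset.mem_powersetCard.1 this).2

lemma choose_le_real (n m : ℕ) (hm : 1 ≤ m) :
    (n.choose m : ℝ) ≤ (3 * (n / m : ℝ)) ^ m := by
  have hm0 : (0:ℝ) < m := by exact_mod_cast hm
  have h1 : (n.choose m : ℝ) ≤ (n:ℝ) ^ m / (m.factorial : ℝ) := Nat.choose_le_pow_div m n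
  have h2 : (m:ℝ) ^ m / (m.factorial : ℝ) ≤ Real.exp m := Real.pow_div_factorial_le_exp m hm0.le m
  have h3 : Real.exp m ≤ 3 ^ m := by
    rw [← Real.exp_one_pow]
    exact pow_le_pow_left₀ (Real.exp_pos _).le (by linarith [Real.exp_one_lt_d9]) _
  have hf : (0:ℝ) < m.factorial := by exact_mod_cast m.factorial_pos
  have h4 : (m:ℝ) ^ m ≤ 3 ^ m * m.factorial := by
    rw [div_le_iff₀ hf] at h2
    exact h2.trans (mul_le_mul_of_nonneg_right h3 hf.le)
  refine h1.trans ?_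
  rw [mul_pow, div_pow, ← mul_div_assoc, div_le_div_iff₀ hf (by positivity)]
  calc (n:ℝ) ^ m * (m:ℝ) ^ m ≤ n ^ m * (3 ^ m * m.factorial) := by gcongr
    _ = _ := by ring

lemma numeric (n m b a M L : ℕ) (D : ℝ) (hm : 1 ≤ m) (hb : 3 * m ≤ 5 * b)
    (ha : a ≤ n) (hM : M ≤ n) (hD : (2:ℝ) ^ 36 ≤ D) (hDn : m * D ^ 10 ≤ n)
    (hL : (n:ℝ) ≤ 2 * D * L) :
    (a.choose m * (M.choose b * (m ^ 3) ^ b) : ℝ) ≤ (1 / 4) ^ m * (L:ℝ) ^ (3 * b) := by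
  have hm0 : (0:ℝ) < m := by exact_mod_cast hm
  have hb1 : 1 ≤ b := by omega
  have hb0 : (0:ℝ) < b := by exact_mod_cast hb1
  have hD0 : (0:ℝ) < D := lt_of_lt_of_le (by positivity) hD
  have hn0 : (0:ℝ) < n := lt_of_lt_of_le (by positivity) hDn
  have hL0 : (0:ℝ) < L := by
    by_contra h
    have : (L:ℝ) ≤ 0 := not_lt.1 h
    have : 2 * D * L ≤ 0 := mul_nonpos_of_nonneg_of_nonpos (by positivity) this
    linarith
  set x : ℝ := n / m with hx
  have hx0 : 0 < x := by positivity
  have hxD : D ^ 10 ≤ x := by rw [hx, le_div_iff₀ hm0]; linarith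
  have c1 : (a.choose m : ℝ) ≤ (3 * x) ^ m :=
    (Nat.cast_le.2 (Nat.choose_le_choose m ha)).trans (choose_le_real n m hm)
  have c2 : (M.choose b : ℝ) ≤ (5 * x) ^ b := by
    refine (Nat.cast_le.2 (Nat.choose_le_choose b hM)).trans ((choose_le_real n b hb1).trans ?_)
    apply pow_le_pow_left₀ (by positivity)
    have : (3 * m : ℝ) ≤ 5 * b := by exact_mod_cast hb
    rw [hx, ← mul_div_assoc, ← mul_div_assoc, div_le_div_iff₀ hb0 hm0]
    nlinarith
  have c3 : ((m:ℝ) ^ 3) ^ b ≤ ((2 * D / x) ^ 3) ^ b * (L:ℝ) ^ (3 * b) := by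
    rw [pow_mul, ← mul_pow, ← mul_pow]
    apply pow_le_pow_left₀ (by positivity)
    apply pow_le_pow_left₀ (by positivity)
    rw [hx]
    field_simp
    linarith
  set q : ℝ := 40 * D ^ 3 / x ^ 2 with hq
  have hq0 : 0 < q := by positivity
  have hD1 : 1 ≤ D := le_trans (by norm_num) hD
  have hq1 : q ≤ 1 := by
    rw [hq, div_le_one (by positivity)]
    calc 40 * D ^ 3 ≤ D ^ 17 * D ^ 3 := by
          gcongr
          calc (40:ℝ) ≤ 2 ^ 36 := by norm_num
            _ ≤ D := hD
            _ ≤ D ^ 17 := le_self_pow₀ hD1 (by norm_num)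
      _ = (D ^ 10) ^ 2 := by ring
      _ ≤ x ^ 2 := by gcongr
  have key : (3 * x) ^ m * q ^ b ≤ (1 / 4) ^ m := by
    apply le_of_pow_le_pow_left₀ (n := 5) (by norm_num) (by positivity)
    calc ((3 * x) ^ m * q ^ b) ^ 5 = ((3 * x) ^ 5) ^ m * q ^ (5 * b) := by
          rw [mul_pow, ← pow_mul, ← pow_mul, ← pow_mul, mul_comm m, mul_comm b]
      _ ≤ ((3 * x) ^ 5) ^ m * q ^ (3 * m) := by
          gcongr ?_ * ?_
          exact pow_le_pow_of_le_one hq0.le hq1 hb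
      _ = ((3 * x) ^ 5 * q ^ 3) ^ m := by rw [mul_pow _ (q ^ 3), ← pow_mul q]
      _ = (15552000 * D ^ 9 / x) ^ m := by
          congr 1
          rw [hq]
          field_simp
          norm_num
      _ ≤ ((1 / 4) ^ 5) ^ m := by
          apply pow_le_pow_left₀ (by positivity)
          rw [div_le_iff₀ hx0]
          have : 2 ^ 36 * D ^ 9 ≤ D ^ 10 := by
            rw [pow_succ' D 9]; gcongr
          have h9 : 0 < D ^ 9 := by positivity
          nlinarith
      _ = _ := by rw [← pow_mul, ← pow_mul, mul_comm]
  calc (a.choose m * (M.choose b * (m ^ 3) ^ b) : ℝ)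
      ≤ (3 * x) ^ m * ((5 * x) ^ b * (((2 * D / x) ^ 3) ^ b * (L:ℝ) ^ (3 * b))) := by gcongr
    _ = (3 * x) ^ m * q ^ b * (L:ℝ) ^ (3 * b) := by
        have : q = 5 * x * (2 * D / x) ^ 3 := by
          rw [hq]; field_simp; norm_num
        rw [this, mul_pow (5 * x)]; ring
    _ ≤ _ := by gcongr

def DD (i : ℕ) : ℕ := 2 ^ (36 ^ (i + 1))

lemma DD_pos (i : ℕ) : 0 < DD i := by unfold DD; positivity

lemma DD_mono {i j : ℕ} (h : i ≤ j) : DD i ≤ DD j := by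
  unfold DD
  exact Nat.pow_le_pow_right (by norm_num) (Nat.pow_le_pow_right (by norm_num) (by omega))

lemma DD_ge (i : ℕ) : 2 ^ 36 ≤ DD i := by
  have := DD_mono (Nat.zero_le i)
  simpa [DD] using this

lemma DD_growth0 (i : ℕ) : 4 * 2 ^ i ≤ DD i := by
  unfold DD
  rw [show (4:ℕ) = 2 ^ 2 by norm_num, ← pow_add]
  apply Nat.pow_le_pow_right (by norm_num)
  have := Nat.lt_pow_self (n := i + 1) (a := 36) (by norm_num)
  omega

lemma DD_growth {s i : ℕ} (h : s < i) : DD s ^ 10 * (30 * 2 ^ i) ≤ DD i := by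
  have h1 : DD s ^ 10 * (30 * 2 ^ i) ≤ DD s ^ 10 * (2 ^ 5 * 2 ^ i) := by
    gcongr; norm_num
  refine h1.trans ?_
  unfold DD
  rw [← pow_mul, ← pow_add, ← pow_add]
  apply Nat.pow_le_pow_right (by norm_num)
  have a1 := Nat.lt_pow_self (n := i) (a := 36) (by norm_num)
  have a2 : 36 ^ (s + 1) ≤ 36 ^ i := Nat.pow_le_pow_right (by norm_num) h
  rw [pow_succ 36 i]
  omega

lemma sum_small {k : ℕ} (T : Finset (Fin k)) (N : Fin k → ℕ) (K X : ℕ)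
    (h : ∀ i ∈ T, N i * (K * 2 ^ (i : ℕ)) ≤ X) : K * ∑ i ∈ T, N i ≤ 2 * X := by
  have h1 : ∀ i ∈ T, (K * N i : ℝ) ≤ X * (1 / 2) ^ (i : ℕ) := by
    intro i hi
    have : (N i * (K * 2 ^ (i : ℕ)) : ℝ) ≤ X := by exact_mod_cast h i hi
    rw [one_div, inv_pow, ← div_eq_mul_inv, le_div_iff₀ (by positivity)]
    linarith
  have h2 : (K * ∑ i ∈ T, N i : ℝ) ≤ 2 * X := by
    rw [Nat.cast_sum, Finset.mul_sum]
    calc ∑ i ∈ T, (K * N i : ℝ) ≤ ∑ i ∈ T, (X * (1 / 2) ^ (i : ℕ) : ℝ) := Finset.sum_le_sum h1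
      _ ≤ ∑ i : Fin k, (X * (1 / 2) ^ (i : ℕ) : ℝ) :=
          Finset.sum_le_sum_of_subset_of_nonneg (Finset.subset_univ _)
            (fun _ _ _ => by positivity)
      _ = X * ∑ i ∈ Finset.range k, (1 / 2 : ℝ) ^ i := by
          rw [← Finset.mul_sum, Fin.sum_univ_eq_sum_range (fun i => (1 / 2 : ℝ) ^ i)]
      _ ≤ X * 2 := by
          gcongr
          exact sum_geometric_two_le k
      _ = _ := by ring
  exact_mod_cast h2

def NN (n : ℕ) {k : ℕ} (i : Fin k) : ℕ := n / DD i

lemma sum_NN (n k : ℕ) : 2 * ∑ i : Fin k, NN n i ≤ n := by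
  have := sum_small (Finset.univ) (fun i : Fin k => NN n i) 4 n (fun i _ => by
    calc NN n i * (4 * 2 ^ (i : ℕ)) ≤ NN n i * DD i := Nat.mul_le_mul_left _ (DD_growth0 i)
      _ ≤ n := Nat.div_mul_le_self _ _)
  omega

def SS (n k m : ℕ) : Finset (Fin k) := Finset.univ.filter (fun i => m * DD i ^ 10 ≤ n)

lemma bad_small (n k m : ℕ) (hk : ∀ i : Fin k, DD i ≤ n) (hm : 1 ≤ m) :
    ((Finset.univ.filter (fun f : ∀ p : Fin (n / 2) × Fin k, Fin (NN n p.2) =>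
      Bad (fun i => NN n i) m ((3 * m + 4) / 5) (SS n k m) f)).card : ℝ) ≤
    (1 / 4) ^ m * ((∏ p : Fin (n / 2) × Fin k, NN n p.2 : ℕ) : ℝ) := by
  by_cases hS : (SS n k m).Nonempty
  · set t := (SS n k m).max' hS with ht
    have htm : t ∈ SS n k m := Finset.max'_mem _ _
    have htm' : m * DD t ^ 10 ≤ n := (Finset.mem_filter.1 htm).2
    have hLN : ∀ i ∈ SS n k m, NN n t ≤ NN n i := by
      intro i hi
      have : i ≤ t := Finset.le_max' _ _ hi
      exact Nat.div_le_div_left (DD_mono this) (DD_pos _)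
    have hc := count_bad (a := n / 2) (fun i => NN n i) m ((3 * m + 4) / 5) (NN n t) (SS n k m) hLN
    have hd : 0 < NN n t := Nat.div_pos (hk t) (DD_pos _)
    have hnum := numeric n m ((3 * m + 4) / 5) (n / 2) (∑ i : Fin k, NN n i) (NN n t) (DD t) hm
      (by omega) (by omega) (by have := sum_NN n k; omega) (by exact_mod_cast DD_ge t)
      (by exact_mod_cast htm') (by
        have h1 : n < NN n t * DD t + DD t := Nat.lt_div_mul_add (DD_pos _)
        have h2 : n ≤ 2 * DD t * NN n t := by nlinarith
        exact_mod_cast h2)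
    have hc' := (Nat.cast_le (α := ℝ)).2 hc
    rw [Nat.cast_mul, Nat.cast_mul, Nat.cast_mul, Nat.cast_mul] at hc'
    have hLpos : (0:ℝ) < (NN n t : ℝ) ^ (3 * ((3 * m + 4) / 5)) := by
      have : (0:ℝ) < NN n t := by exact_mod_cast hd
      positivity
    push_cast at hc' hnum ⊢
    refine le_of_mul_le_mul_right (hc'.trans ?_) hLpos
    have hP : (0:ℝ) ≤ ∏ p : Fin (n / 2) × Fin k, (NN n p.2 : ℝ) :=
      Finset.prod_nonneg fun _ _ => by positivity
    have := mul_le_mul_of_nonneg_right hnum hP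
    linarith
  · rw [Finset.filter_false_of_mem]
    · rw [Finset.card_empty, Nat.cast_zero]; positivity
    · rintro f - ⟨A', -, B', hB, hBS, -⟩
      obtain ⟨v, hv⟩ : B'.Nonempty := Finset.card_pos.1 (by omega)
      exact hS ⟨_, hBS v hv⟩

lemma exists_good (n k : ℕ) (hk : ∀ i : Fin k, DD i ≤ n) :
    ∃ f : ∀ p : Fin (n / 2) × Fin k, Fin (NN n p.2), ∀ m ≥ 1,
      ¬ Bad (fun i => NN n i) m ((3 * m + 4) / 5) (SS n k m) f := by
  by_contra hcon
  push Not at hcon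
  have hsub : (Finset.univ : Finset (∀ p : Fin (n / 2) × Fin k, Fin (NN n p.2))) ⊆
      (Finset.range (n / 2)).biUnion (fun j => Finset.univ.filter (fun f =>
        Bad (fun i => NN n i) (j + 1) ((3 * (j + 1) + 4) / 5) (SS n k (j + 1)) f)) := by
    intro f _
    obtain ⟨m, hm, hb⟩ := hcon f
    have hma : m ≤ n / 2 := by
      obtain ⟨A', hA, -⟩ := hb
      rw [← hA]
      simpa using Finset.card_le_univ A'
    obtain ⟨j, rfl⟩ : ∃ j, m = j + 1 := ⟨m - 1, by omega⟩
    simp only [Finset.mem_biUnion, Finset.mem_range, Finset.mem_filter, Finset.mem_univ, true_and]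
    exact ⟨j, by omega, hb⟩
  have h1 := (Finset.card_le_card hsub).trans Finset.card_biUnion_le
  set P : ℕ := ∏ p : Fin (n / 2) × Fin k, NN n p.2 with hP
  have hPpos : 0 < P := Finset.prod_pos fun p _ => Nat.div_pos (hk _) (DD_pos _)
  have hcard : (Finset.univ : Finset (∀ p : Fin (n / 2) × Fin k, Fin (NN n p.2))).card = P := by
    rw [Finset.card_univ, Fintype.card_pi]
    simp [hP]
  rw [hcard] at h1
  have h2 := (Nat.cast_le (α := ℝ)).2 h1
  rw [Nat.cast_sum] at h2
  have h3 : (P:ℝ) ≤ ∑ j ∈ Finset.range (n / 2), (1 / 4 : ℝ) * P * (1 / 2) ^ j := by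
    refine h2.trans (Finset.sum_le_sum fun j _ => ?_)
    refine (bad_small n k (j + 1) hk (by omega)).trans ?_
    rw [← hP, pow_succ]
    have : (1 / 4 : ℝ) ^ j ≤ (1 / 2) ^ j := pow_le_pow_left₀ (by norm_num) (by norm_num) _
    have hP0 : (0:ℝ) ≤ P := by positivity
    nlinarith [mul_le_mul_of_nonneg_right this hP0]
  rw [← Finset.mul_sum] at h3
  have h4 := sum_geometric_two_le (n / 2)
  have hP1 : (0:ℝ) < P := by exact_mod_cast hPpos
  nlinarith [mul_le_mul_of_nonneg_left h4 hP1.le]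

/-- Most of the mass lies on the low levels. -/
lemma low_mass (n k m : ℕ) (β : Fin k → ℕ) (h3 : ∀ i, 3 * β i ≤ m) (hN : ∀ i, β i ≤ NN n i)
    (hsum : ∑ i, β i = m) : 3 * m ≤ 5 * ∑ i ∈ SS n k m, β i := by
  by_cases hS : (SS n k m)ᶜ.Nonempty
  · set s := (SS n k m)ᶜ.min' hS with hs
    have hsm : s ∈ (SS n k m)ᶜ := Finset.min'_mem _ _
    have hs1 : n < m * DD s ^ 10 := by
      simpa [SS] using hsm
    have hsplit : ∑ i ∈ SS n k m, β i + ∑ i ∈ (SS n k m)ᶜ, β i = m := by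
      rw [Finset.sum_add_sum_compl, hsum]
    rw [← Finset.add_sum_erase _ _ hsm] at hsplit
    have hhigh : 30 * ∑ i ∈ ((SS n k m)ᶜ).erase s, β i ≤ 2 * m := by
      apply sum_small
      intro i hi
      have hne : i ≠ s := Finset.ne_of_mem_erase hi
      have hle : s ≤ i := Finset.min'_le _ _ (Finset.mem_of_mem_erase hi)
      have hlt : (s : ℕ) < i := lt_of_le_of_ne hle (fun h => hne (Fin.ext h.symm))
      have hg := DD_growth hlt
      have hN' : NN n i * DD i ≤ n := Nat.div_mul_le_self _ _
      have hpos : 0 < DD s ^ 10 := pow_pos (DD_pos _) _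
      refine Nat.le_of_mul_le_mul_left ?_ hpos
      calc DD s ^ 10 * (β i * (30 * 2 ^ (i : ℕ))) = β i * (DD s ^ 10 * (30 * 2 ^ (i : ℕ))) := by ring
        _ ≤ NN n i * DD i := Nat.mul_le_mul (hN i) hg
        _ ≤ n := hN'
        _ ≤ m * DD s ^ 10 := hs1.le
        _ = _ := by ring
    have := h3 s
    omega
  · rw [Finset.not_nonempty_iff_eq_empty, Finset.compl_eq_empty_iff] at hS
    rw [hS, hsum]; omega

lemma core {n k : ℕ} (f : ∀ p : Fin (n / 2) × Fin k, Fin (NN n p.2))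
    (hf : ∀ m ≥ 1, ¬ Bad (fun i => NN n i) m ((3 * m + 4) / 5) (SS n k m) f)
    (A : Finset (Fin (n / 2))) (B : Finset (Σ i : Fin k, Fin (NN n i)))
    (R : Fin (n / 2) → (Σ i : Fin k, Fin (NN n i)) → Prop)
    (hR : ∀ x v, R x v → f (x, v.1) = v.2)
    (hA : ∀ x ∈ A, (B.filter (fun v => R x v)).card = 3)
    (hB : ∀ v ∈ B, (A.filter (fun x => R x v)).card = 3) : A = ∅ := by
  have hAB : A.card = B.card := by
    have := Finset.sum_card_bipartiteAbove_eq_sum_card_bipartiteBelow (s := A) (t := B) R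
    unfold Finset.bipartiteAbove Finset.bipartiteBelow at this
    rw [Finset.sum_congr rfl hA, Finset.sum_congr rfl hB] at this
    simp at this
    exact this
  by_contra hne
  have hm : 1 ≤ A.card := Finset.card_pos.2 (Finset.nonempty_iff_ne_empty.2 hne)
  set β : Fin k → ℕ := fun i => (B.filter (fun v => v.1 = i)).card with hβ
  have hsum : ∀ T : Finset (Fin k), ∑ i ∈ T, β i = (B.filter (fun v => v.1 ∈ T)).card := by
    intro T
    rw [Finset.card_eq_sum_card_fiberwise (f := fun v => v.1) (t := T)]
    · apply Finset.sum_congr rfl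
      intro i hi
      rw [Finset.filter_filter]
      refine congrArg Finset.card ?_
      ext v
      simp only [Finset.mem_filter]
      constructor
      · rintro ⟨h1, rfl⟩; exact ⟨h1, hi, rfl⟩
      · rintro ⟨h1, -, h2⟩; exact ⟨h1, h2⟩
    · intro v hv
      exact (Finset.mem_filter.1 hv).2
  have hlow := low_mass n k A.card β ?_ ?_ ?_
  · rw [hsum] at hlow
    obtain ⟨B', hB', hc⟩ := Finset.exists_subset_card_eq
      (s := B.filter (fun v => v.1 ∈ SS n k A.card)) (n := (3 * A.card + 4) / 5) (by omega)
    refine hf A.card hm ⟨A, rfl, B', hc, fun v hv => (Finset.mem_filter.1 (hB' hv)).2,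
      fun v hv => ?_⟩
    rw [← hB v (Finset.mem_filter.1 (hB' hv)).1]
    apply Finset.card_le_card
    intro x hx
    rw [Finset.mem_filter] at hx ⊢
    exact ⟨hx.1, hR _ _ hx.2⟩
  · intro i
    have h1 : ((B.filter (fun v => v.1 = i)).biUnion (fun v => A.filter (fun x => R x v))).card
        = ∑ v ∈ B.filter (fun v => v.1 = i), (A.filter (fun x => R x v)).card := by
      apply Finset.card_biUnion
      rintro ⟨i1, u⟩ hu ⟨i2, w⟩ hw hne
      rw [Finset.mem_coe, Finset.mem_filter] at hu hw
      obtain ⟨-, rfl⟩ := hu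
      obtain ⟨-, h⟩ := hw
      simp only at h
      subst h
      rw [Function.onFun, Finset.disjoint_left]
      intro x hx hy
      have e1 := hR _ _ (Finset.mem_filter.1 hx).2
      have e2 := hR _ _ (Finset.mem_filter.1 hy).2
      simp only at e1 e2
      exact hne (by rw [← e1, ← e2])
    have h2 : ∑ v ∈ B.filter (fun v => v.1 = i), (A.filter (fun x => R x v)).card = 3 * β i := by
      rw [Finset.sum_congr rfl (fun v hv => hB v (Finset.mem_filter.1 hv).1)]
      simp [hβ, mul_comm]
    rw [← h2, ← h1]
    apply Finset.card_le_card
    intro x hx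
    obtain ⟨v, -, hx⟩ := Finset.mem_biUnion.1 hx
    exact (Finset.mem_filter.1 hx).1
  · intro i
    have : (B.filter (fun v => v.1 = i)) ⊆
        (Finset.univ : Finset (Fin (NN n i))).image (fun u => ⟨i, u⟩) := by
      rintro ⟨j, u⟩ hv
      have h := (Finset.mem_filter.1 hv).2
      simp only at h
      subst h
      exact Finset.mem_image.2 ⟨u, Finset.mem_univ _, rfl⟩
    refine (Finset.card_le_card this).trans (Finset.card_image_le.trans ?_)
    simp
  · rw [hsum]; simp [hAB]

lemma graph_exists (n k : ℕ) (hk : ∀ i : Fin k, DD i ≤ n) :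
    ∃ G : SimpleGraph (Fin n), Bip G ∧ (n / 2) * k ≤ G.edgeFinset.card ∧
      ¬ ∃ (s : Set (Fin n)) (H : SimpleGraph s), s.Nonempty ∧ H ≤ G.induce s ∧
            ∀ v : s, H.degree v = 3 := by
  obtain ⟨f, hf⟩ := exists_good n k hk
  obtain ⟨e⟩ : Nonempty ((Fin (n / 2) ⊕ (Σ i : Fin k, Fin (NN n i))) ↪ Fin n) := by
    apply Function.Embedding.nonempty_of_card_le
    have := sum_NN n k
    simp
    omega
  obtain ⟨E, hE⟩ : ∃ E : Fin n → Fin n → Prop, ∀ y z, E y z ↔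
    ∃ (x : Fin (n / 2)) (i : Fin k), y = e (Sum.inl x) ∧ z = e (Sum.inr ⟨i, f (x, i)⟩) :=
    ⟨_, fun _ _ => Iff.rfl⟩
  have hdis : ∀ x v, e (Sum.inl x) ≠ e (Sum.inr v) := fun x v h => by
    have := e.injective h
    simp at this
  have hinl : ∀ x y, e (Sum.inl x) = e (Sum.inl y) → x = y := fun x y h => by
    have := e.injective h
    simpa using this
  have hinr : ∀ x y, e (Sum.inr x) = e (Sum.inr y) → x = y := fun x y h => by
    have := e.injective h
    simpa using this
  obtain ⟨G, hG⟩ : ∃ G : SimpleGraph (Fin n), ∀ y z, G.Adj y z ↔ (E y z ∨ E z y) :=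
    ⟨{ Adj := fun y z => E y z ∨ E z y
       symm := ⟨fun y z h => h.symm⟩
       loopless := ⟨by
        intro y h
        have h' : E y y := by rcases h with h | h <;> exact h
        obtain ⟨x, i, h1, h2⟩ := (hE _ _).1 h'
        exact hdis _ _ (h1.symm.trans h2)⟩ }, fun _ _ => Iff.rfl⟩
  simp only [hE] at hG
  have hadj : ∀ x v, G.Adj (e (Sum.inl x)) (e (Sum.inr v)) → f (x, v.1) = v.2 := by
    intro x v hxv
    rcases (hG _ _).1 hxv with ⟨x', i, h1, h2⟩ | ⟨x', i, h1, h2⟩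
    · have := hinl _ _ h1
      subst this
      have := hinr _ _ h2
      subst this
      rfl
    · exact absurd h2 (hdis _ _)
  refine ⟨G, ⟨Set.range (fun x => e (Sum.inl x)), ?_⟩, ?_, ?_⟩
  · have hno : ∀ y z, E y z → y ∈ Set.range (fun x => e (Sum.inl x)) ∧
        z ∉ Set.range (fun x => e (Sum.inl x)) := by
      intro y z hyz
      obtain ⟨x, i, rfl, rfl⟩ := (hE _ _).1 hyz
      refine ⟨⟨x, rfl⟩, ?_⟩
      rintro ⟨x', h⟩
      exact hdis _ _ h
    intro y z hyz
    rw [hG, ← hE, ← hE] at hyz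
    rcases hyz with h | h
    · have := hno _ _ h; tauto
    · have := hno _ _ h; tauto
  · obtain ⟨g, hg⟩ : ∃ g : Fin (n / 2) × Fin k → (Σ i : Fin k, Fin (NN n i)),
        ∀ x i, g (x, i) = ⟨i, f (x, i)⟩ := ⟨fun p => ⟨p.2, f p⟩, fun _ _ => rfl⟩
    have : ((Finset.univ : Finset (Fin (n / 2) × Fin k)).image
        (fun p => s(e (Sum.inl p.1), e (Sum.inr (g p))))).card = n / 2 * k := by
      rw [Finset.card_image_of_injective]
      · simp
      · rintro ⟨x, i⟩ ⟨y, j⟩ h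
        simp only [Sym2.eq_iff] at h
        rcases h with ⟨h1, h2⟩ | ⟨h1, h2⟩
        · have e1 := hinl _ _ h1
          have e2 := congrArg Sigma.fst (hinr _ _ h2)
          rw [hg, hg] at e2
          exact Prod.ext e1 e2
        · exact absurd h1 (hdis _ _)
    rw [← this]
    apply Finset.card_le_card
    intro p hp
    obtain ⟨⟨x, i⟩, -, rfl⟩ := Finset.mem_image.1 hp
    rw [SimpleGraph.mem_edgeFinset, SimpleGraph.mem_edgeSet, hG]
    exact Or.inl ⟨x, i, rfl, by rw [hg]⟩
  · rintro ⟨s, H, ⟨p, hp⟩, hH, hdeg⟩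
    have hHG : ∀ y z : s, H.Adj y z → G.Adj y z := fun y z h => hH h
    set A : Finset (Fin (n / 2)) := Finset.univ.filter (fun x => e (Sum.inl x) ∈ s) with hA
    set B : Finset (Σ i : Fin k, Fin (NN n i)) :=
      Finset.univ.filter (fun v => e (Sum.inr v) ∈ s) with hB
    obtain ⟨R, hR⟩ : ∃ R : Fin (n / 2) → (Σ i : Fin k, Fin (NN n i)) → Prop, ∀ x v, R x v ↔
      ∃ (hx : e (Sum.inl x) ∈ s) (hv : e (Sum.inr v) ∈ s),
        H.Adj ⟨e (Sum.inl x), hx⟩ ⟨e (Sum.inr v), hv⟩ := ⟨_, fun _ _ => Iff.rfl⟩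
    have hempty := core f hf A B R ?_ ?_ ?_
    · have hd := hdeg ⟨p, hp⟩
      have hpos : 0 < H.degree ⟨p, hp⟩ := by omega
      obtain ⟨⟨q, hq⟩, hadjq⟩ := (H.degree_pos_iff_exists_adj _).1 hpos
      have : ∃ x, e (Sum.inl x) ∈ s := by
        rcases (hG _ _).1 (hHG _ _ hadjq) with ⟨x, i, h1, h2⟩ | ⟨x, i, h1, h2⟩
        · exact ⟨x, h1 ▸ hp⟩
        · exact ⟨x, h1 ▸ hq⟩
      obtain ⟨x, hx⟩ := this
      have hxA : x ∈ A := by simp [hA, hx]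
      rw [hempty] at hxA
      simp at hxA
    · intro x v hxv
      obtain ⟨hx, hv, h⟩ := (hR _ _).1 hxv
      exact hadj x v (hHG _ _ h)
    · intro x hx
      have hxs : e (Sum.inl x) ∈ s := (Finset.mem_filter.1 hx).2
      rw [← hdeg ⟨_, hxs⟩, ← SimpleGraph.card_neighborFinset_eq_degree]
      refine Finset.card_bij
        (fun v hv => ⟨e (Sum.inr v), (Finset.mem_filter.1 (Finset.mem_filter.1 hv).1).2⟩) ?_ ?_ ?_
      · intro v hv
        rw [SimpleGraph.mem_neighborFinset]
        obtain ⟨_, _, h⟩ := (hR _ _).1 (Finset.mem_filter.1 hv).2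
        exact h
      · intro v _ w _ h
        exact hinr _ _ (congrArg Subtype.val h)
      · rintro ⟨z, hz⟩ hmem
        rw [SimpleGraph.mem_neighborFinset] at hmem
        rcases (hG _ _).1 (hHG _ _ hmem) with ⟨x', i, h1, h2⟩ | ⟨x', i, h1, h2⟩
        · simp only at h2
          subst h2
          refine ⟨⟨i, f (x', i)⟩, ?_, rfl⟩
          rw [Finset.mem_filter, hB, Finset.mem_filter, hR]
          exact ⟨⟨Finset.mem_univ _, hz⟩, hxs, hz, hmem⟩
        · exact absurd h2 (hdis _ _)
    · intro v hv
      have hvs : e (Sum.inr v) ∈ s := (Finset.mem_filter.1 hv).2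
      rw [← hdeg ⟨_, hvs⟩, ← SimpleGraph.card_neighborFinset_eq_degree]
      refine Finset.card_bij
        (fun x hx => ⟨e (Sum.inl x), (Finset.mem_filter.1 (Finset.mem_filter.1 hx).1).2⟩) ?_ ?_ ?_
      · intro x hx
        rw [SimpleGraph.mem_neighborFinset]
        obtain ⟨_, _, h⟩ := (hR _ _).1 (Finset.mem_filter.1 hx).2
        exact h.symm
      · intro v _ w _ h
        exact hinl _ _ (congrArg Subtype.val h)
      · rintro ⟨z, hz⟩ hmem
        rw [SimpleGraph.mem_neighborFinset] at hmem
        rcases (hG _ _).1 (hHG _ _ hmem) with ⟨x', i, h1, h2⟩ | ⟨x', i, h1, h2⟩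
        · exact absurd h1.symm (hdis _ _)
        · simp only at h1
          subst h1
          refine ⟨x', ?_, rfl⟩
          rw [Finset.mem_filter, hA, Finset.mem_filter, hR]
          exact ⟨⟨Finset.mem_univ _, hz⟩, hz, hvs, hmem.symm⟩

lemma loglog_le (n : ℕ) (hn : 2 ^ 36 ≤ n) :
    ∃ k : ℕ, (∀ i : Fin k, DD i ≤ n) ∧ Real.log (Real.log n) ≤ 8 * k := by
  have hn0 : n ≠ 0 := by
    rintro rfl
    norm_num at hn
  set l := Nat.log 2 n with hl
  have hl36 : 36 ≤ l := (Nat.le_log_iff_pow_le (by norm_num) hn0).2 hn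
  refine ⟨Nat.log 36 l, ?_, ?_⟩
  · intro i
    have h1 : 36 ^ ((i:ℕ) + 1) ≤ l :=
      (Nat.le_log_iff_pow_le (by norm_num) (by omega)).1 i.2
    unfold DD
    exact (Nat.le_log_iff_pow_le (by norm_num) hn0).1 h1
  · set k := Nat.log 36 l with hk
    have hk1 : 1 ≤ k := (Nat.le_log_iff_pow_le (by norm_num) (by omega)).2 (by simpa using hl36)
    have h1 : n < 2 ^ (l + 1) := Nat.lt_pow_succ_log_self (by norm_num) n
    have h2 : l < 36 ^ (k + 1) := Nat.lt_pow_succ_log_self (by norm_num) l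
    have hnpos : (0:ℝ) < n := by exact_mod_cast Nat.pos_of_ne_zero hn0
    have h3 : Real.log n ≤ 36 ^ (k + 1) := by
      have a1 : Real.log n ≤ Real.log ((2:ℝ) ^ (l + 1)) :=
        Real.log_le_log hnpos (by exact_mod_cast h1.le)
      rw [Real.log_pow] at a1
      have a2 : ((l + 1 : ℕ) : ℝ) ≤ 36 ^ (k + 1) := by exact_mod_cast h2
      have a3 : Real.log 2 ≤ 1 := by linarith [Real.log_two_lt_d9]
      have a4 : ((l + 1 : ℕ) : ℝ) * Real.log 2 ≤ (l + 1 : ℕ) * 1 := by gcongr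
      linarith
    have hlogpos : 0 < Real.log n := by
      apply Real.log_pos
      have : 1 < n := lt_of_lt_of_le (by norm_num) hn
      exact_mod_cast this
    have h4 := Real.log_le_log hlogpos h3
    rw [Real.log_pow] at h4
    have h5 : Real.log 36 ≤ 4 := by
      have : Real.log 36 ≤ Real.log (2 ^ 6 : ℝ) - 0 := by
        rw [sub_zero]; exact Real.log_le_log (by norm_num) (by norm_num)
      have h6 : Real.log 36 ≤ Real.log (Real.exp 4) := by
        apply Real.log_le_log (by norm_num)
        have : Real.exp 4 = Real.exp 1 ^ 4 := by rw [← Real.exp_nat_mul]; norm_num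
        rw [this]
        have h27 : (2.7:ℝ) ≤ Real.exp 1 := by linarith [Real.exp_one_gt_d9]
        calc (36:ℝ) ≤ 2.7 ^ 4 := by norm_num
          _ ≤ _ := by gcongr
      simpa using h6
    have hk1' : (1:ℝ) ≤ k := by exact_mod_cast hk1
    push_cast at h4
    nlinarith

/-- Pyber–Rödl–Szemerédi: there are bipartite graphs with `Ω(n log log n)` edges and
no nonempty `3`-regular subgraph. -/
theorem no_three_regular_subgraph :
    ∃ c : ℝ, 0 < c ∧ ∃ n₀ : ℕ, ∀ n ≥ n₀,
      ∃ G : SimpleGraph (Fin n), Bip G ∧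
        c * n * Real.log (Real.log n) ≤ (G.edgeFinset.card : ℝ) ∧
        ¬ ∃ (s : Set (Fin n)) (H : SimpleGraph s), s.Nonempty ∧ H ≤ G.induce s ∧
            ∀ v : s, H.degree v = 3 := by
  refine ⟨1 / 24, by norm_num, 2 ^ 36, fun n hn => ?_⟩
  obtain ⟨k, hk, hlog⟩ := loglog_le n hn
  obtain ⟨G, h1, h2, h3⟩ := graph_exists n k hk
  refine ⟨G, h1, ?_, h3⟩
  have h4 : n ≤ 3 * (n / 2) := by
    have : 2 ≤ n := le_trans (by norm_num) hn
    omega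
  have h5 : (n:ℝ) ≤ 3 * ((n / 2 : ℕ) : ℝ) := by exact_mod_cast h4
  have h6 : (((n / 2 : ℕ) : ℝ) * k) ≤ (G.edgeFinset.card : ℝ) := by exact_mod_cast h2
  have hk0 : (0:ℝ) ≤ k := by positivity
  have hn0 : (0:ℝ) ≤ n := by positivity
  calc 1 / 24 * (n:ℝ) * Real.log (Real.log n) ≤ 1 / 24 * n * (8 * k) := by gcongr
    _ ≤ ((n / 2 : ℕ) : ℝ) * k := by nlinarith [mul_le_mul_of_nonneg_right h5 hk0]
    _ ≤ _ := h6
end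
end

section
/- There is a function f : ℕ → ℕ such that for every natural number d, every finite simple graph G with minimum degree δ(G) ≥ f(d) has a nonempty induced subgraph H such that either H is isomorphic to the complete graph K_d, or δ(H) > d and H is bipartite. -/
open SimpleGraph
open scoped Classical

noncomputable section

/-- Minimum degree of a finite simple graph. -/
def minDeg {V : Type} [Fintype V] (G : SimpleGraph V) : ℕ :=
  G.minDegree

/-- Number of neighbours of `v` in `S`. -/
def dg {V : Type} (G : SimpleGraph V) (v : V) (S : Finset V) : ℕ :=
  (S.filter (fun u => G.Adj v u)).card

/-- `S` is an independent set. -/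
def Ind {V : Type} (G : SimpleGraph V) (S : Finset V) : Prop :=
  ∀ u ∈ S, ∀ v ∈ S, ¬ G.Adj u v

/-- The independent subsets of `S`. -/
def indsets {V : Type} (G : SimpleGraph V) (S : Finset V) : Finset (Finset V) :=
  S.powerset.filter (fun I => Ind G I)

lemma Ind.mono {V : Type} {G : SimpleGraph V} {S T : Finset V} (h : Ind G T) (hs : S ⊆ T) :
    Ind G S := fun u hu v hv => h u (hs hu) v (hs hv)

lemma mem_indsets {V : Type} {G : SimpleGraph V} {S I : Finset V} :
    I ∈ indsets G S ↔ I ⊆ S ∧ Ind G I := by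
  simp [indsets]

lemma dg_comm {V : Type} (G : SimpleGraph V) (S T : Finset V) :
    ∑ v ∈ S, dg G v T = ∑ u ∈ T, dg G u S := by
  simp only [dg, Finset.card_filter]
  rw [Finset.sum_comm]
  simp only [G.adj_comm]

lemma dg_mono {V : Type} (G : SimpleGraph V) (v : V) {S T : Finset V} (h : S ⊆ T) :
    dg G v S ≤ dg G v T := Finset.card_le_card (Finset.filter_subset_filter _ h)

lemma ramsey_poly {V : Type} (G : SimpleGraph V) (a : ℕ) (ha : 1 ≤ a) (r : ℕ) :
    ∀ T : Finset V, a ^ r ≤ T.card →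
      (∃ Q ⊆ T, G.IsNClique r Q) ∨ ∃ I ⊆ T, Ind G I ∧ I.card = a := by
  induction r with
  | zero =>
    intro T _
    left
    exact ⟨∅, by simp, by simp⟩
  | succ r ih =>
    intro T hT
    obtain ⟨I, hI, hmax⟩ := Finset.exists_max_image (indsets G T) Finset.card
      ⟨∅, by simp [mem_indsets, Ind]⟩
    rw [mem_indsets] at hI
    by_cases hc : a ≤ I.card
    · right
      obtain ⟨J, hJ, hJc⟩ := Finset.exists_subset_card_eq hc
      exact ⟨J, hJ.trans hI.1, hI.2.mono hJ, hJc⟩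
    · push Not at hc
      by_cases hy : ∃ y ∈ I, a ^ r ≤ dg G y T
      · obtain ⟨y, hyI, hyd⟩ := hy
        rcases ih (T.filter (fun u => G.Adj y u)) hyd with ⟨Q, hQ, hQc⟩ | ⟨J, hJ, hJ2⟩
        · left
          refine ⟨insert y Q, ?_, ?_⟩
          · intro z hz
            rcases Finset.mem_insert.1 hz with rfl | hz
            · exact hI.1 hyI
            · exact Finset.mem_of_mem_filter _ (hQ hz)
          · exact hQc.insert (fun b hb => (Finset.mem_filter.1 (hQ hb)).2)
        · right
          exact ⟨J, hJ.trans (Finset.filter_subset _ _), hJ2⟩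
      · exfalso
        push Not at hy
        have hcov : T ⊆ I.biUnion (fun y => insert y (T.filter (fun u => G.Adj y u))) := by
          intro z hz
          rw [Finset.mem_biUnion]
          by_contra hcon
          push Not at hcon
          have hzI : z ∉ I := fun h => hcon z h (Finset.mem_insert_self _ _)
          have hna : ∀ y ∈ I, ¬ G.Adj y z := fun y hy hadj =>
            hcon y hy (Finset.mem_insert_of_mem (by simp [hz, hadj]))
          have : insert z I ∈ indsets G T := by
            rw [mem_indsets]
            refine ⟨Finset.insert_subset hz hI.1, ?_⟩
            intro u hu v hv
            rcases Finset.mem_insert.1 hu with hu1 | hu1 <;>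
              rcases Finset.mem_insert.1 hv with hv1 | hv1
            · rw [hu1, hv1]; exact G.loopless.irrefl _
            · rw [hu1]; exact fun h => hna v hv1 h.symm
            · rw [hv1]; exact hna u hu1
            · exact hI.2 u hu1 v hv1
          have := hmax _ this
          rw [Finset.card_insert_of_notMem hzI] at this
          omega
        have h1 := Finset.card_le_card hcov
        have h2 : (I.biUnion (fun y => insert y (T.filter (fun u => G.Adj y u)))).card
            ≤ I.card * a ^ r := by
          apply Finset.card_biUnion_le_card_mul
          intro y hyI
          have := hy y hyI
          unfold dg at this
          exact (Finset.card_insert_le _ _).trans this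
        have h3 : I.card * a ^ r < a * a ^ r := Nat.mul_lt_mul_of_pos_right hc (by positivity)
        rw [pow_succ, mul_comm] at hT
        omega

lemma card_small_subsets {V : Type} (T : Finset V) (m : ℕ) :
    (T.powerset.filter (fun X => X.card < m)).card ≤ (T.card + 2) ^ m := by
  induction m with
  | zero => simp
  | succ m ih =>
    have : T.powerset.filter (fun X => X.card < m + 1) ⊆
        T.powerset.filter (fun X => X.card < m) ∪ T.powersetCard m := by
      intro X hX
      simp only [Finset.mem_filter, Finset.mem_powerset, Finset.mem_union,
        Finset.mem_powersetCard] at *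
      rcases lt_or_eq_of_le (Nat.lt_succ_iff.1 hX.2) with h | h
      · exact Or.inl ⟨hX.1, h⟩
      · exact Or.inr ⟨hX.1, h⟩
    have h1 := (Finset.card_le_card this).trans (Finset.card_union_le _ _)
    rw [Finset.card_powersetCard] at h1
    have h2 : T.card.choose m ≤ (T.card + 2) ^ m :=
      (Nat.choose_le_pow _ _).trans (Nat.pow_le_pow_left (by omega) _)
    rw [pow_succ]
    nlinarith [Nat.zero_le (T.card), Nat.zero_le ((T.card + 2) ^ m)]

lemma exists_exp_bound (k : ℕ) : ∃ a0 : ℕ, ∀ a ≥ a0, 2 * (a + 2) ^ k ≤ 2 ^ a := by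
  have h := tendsto_pow_const_div_const_pow_of_one_lt k (r := (2 : ℝ)) (by norm_num)
  have h2 := h.eventually (gt_mem_nhds (show (0 : ℝ) < 1 / 8 by norm_num))
  obtain ⟨a0, ha0⟩ := Filter.eventually_atTop.1 h2
  refine ⟨a0, fun a ha => ?_⟩
  have h3 := ha0 (a + 2) (by omega)
  rw [div_lt_iff₀ (by positivity)] at h3
  have h4 : (2 * (a + 2) ^ k : ℝ) ≤ 2 ^ a := by
    rw [pow_add] at h3
    push_cast at h3
    linarith
  exact_mod_cast h4

/-- In a `K_r`-free graph the average independent set is large, up to a constant. -/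
lemma avg_indset (k r : ℕ) : ∃ C : ℕ, ∀ (V : Type) (G : SimpleGraph V), G.CliqueFree r →
    ∀ T : Finset V, k * (1 + (indsets G T).card) ≤ C + ∑ X ∈ indsets G T, X.card := by
  rcases Nat.eq_zero_or_pos r with rfl | hr
  · refine ⟨0, fun V G hG => ?_⟩
    exact absurd (by simp : G.IsNClique 0 ∅) (hG ∅)
  obtain ⟨a0, ha0⟩ := exists_exp_bound (r * (2 * k))
  refine ⟨k * (1 + 2 ^ ((a0 + 1) ^ r)), fun V G hG T => ?_⟩
  rcases lt_or_ge T.card ((a0 + 1) ^ r) with hT | hT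
  · have h1 : (indsets G T).card ≤ 2 ^ T.card := by
      rw [← Finset.card_powerset]
      exact Finset.card_le_card (Finset.filter_subset _ _)
    have h2 : 2 ^ T.card ≤ 2 ^ ((a0 + 1) ^ r) := Nat.pow_le_pow_right (by norm_num) hT.le
    have h3 : k * (1 + (indsets G T).card) ≤ k * (1 + 2 ^ ((a0 + 1) ^ r)) :=
      Nat.mul_le_mul_left _ (by omega)
    omega
  · have hex : ∃ b, T.card < (b + 1) ^ r :=
      ⟨T.card, lt_of_lt_of_le (Nat.lt_succ_self _) (Nat.le_self_pow (by omega) _)⟩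
    set a := Nat.find hex with hadef
    have ha1 : T.card < (a + 1) ^ r := Nat.find_spec hex
    have ha2 : a0 + 1 ≤ a := by
      have := lt_of_le_of_lt hT ha1
      have := lt_of_pow_lt_pow_left₀ r (by omega) this
      omega
    have ha3 : a ^ r ≤ T.card := by
      have := Nat.find_min hex (m := a - 1) (by omega)
      rw [Nat.sub_add_cancel (by omega)] at this
      omega
    rcases ramsey_poly G a (by omega) r T ha3 with ⟨Q, _, hQ⟩ | ⟨I, hIT, hI, hIa⟩
    · exact absurd hQ (hG Q)
    have hi : 2 ^ a ≤ (indsets G T).card := by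
      rw [← hIa, ← Finset.card_powerset]
      apply Finset.card_le_card
      intro X hX
      rw [Finset.mem_powerset] at hX
      exact mem_indsets.2 ⟨hX.trans hIT, hI.mono hX⟩
    have hsmall : 2 * ((indsets G T).filter (fun X => X.card < 2 * k)).card ≤ 2 ^ a := by
      have h1 : ((indsets G T).filter (fun X => X.card < 2 * k)).card ≤ (T.card + 2) ^ (2 * k) :=
        (Finset.card_le_card (Finset.filter_subset_filter _ (Finset.filter_subset _ _))).trans
          (card_small_subsets T (2 * k))
      have h2 : T.card + 2 ≤ (a + 2) ^ r := by
        have : (a + 1) ^ r < (a + 2) ^ r := Nat.pow_lt_pow_left (by omega) (by omega)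
        omega
      have h3 : (T.card + 2) ^ (2 * k) ≤ (a + 2) ^ (r * (2 * k)) := by
        rw [pow_mul (a + 2)]; exact Nat.pow_le_pow_left h2 _
      have := ha0 a (by omega)
      omega
    have hsum : 2 * k * ((indsets G T).filter (fun X => ¬ X.card < 2 * k)).card
        ≤ ∑ X ∈ indsets G T, X.card := by
      calc _ = ∑ X ∈ (indsets G T).filter (fun X => ¬ X.card < 2 * k), 2 * k := by
            rw [Finset.sum_const, smul_eq_mul, mul_comm]
        _ ≤ ∑ X ∈ (indsets G T).filter (fun X => ¬ X.card < 2 * k), X.card := by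
            apply Finset.sum_le_sum
            intro X hX
            have := (Finset.mem_filter.1 hX).2
            omega
        _ ≤ _ := Finset.sum_le_sum_of_subset (Finset.filter_subset _ _)
    have hsplit := Finset.card_filter_add_card_filter_not (s := indsets G T)
      (fun X => X.card < 2 * k)
    have h5 : (indsets G T).card ≤ 2 * ((indsets G T).filter (fun X => ¬ X.card < 2 * k)).card := by
      omega
    have h6 := Nat.mul_le_mul_left k h5
    have h7 : 0 ≤ k * 2 ^ ((a0 + 1) ^ r) := Nat.zero_le _
    nlinarith

lemma local_indset {V : Type} (G : SimpleGraph V) (k C : ℕ)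
    (hC : ∀ T : Finset V, k * (1 + (indsets G T).card) ≤ C + ∑ X ∈ indsets G T, X.card)
    (S : Finset V) (v : V) (hv : v ∈ S) :
    k * (indsets G S).card ≤ ∑ I ∈ indsets G S, ((if v ∈ I then C else 0) + dg G v I) := by
  let φ : Finset V → Finset V := fun I => I.filter (fun u => u ≠ v ∧ ¬ G.Adj v u)
  have hmaps : ∀ I ∈ indsets G S, φ I ∈ (indsets G S).image φ :=
    fun I hI => Finset.mem_image_of_mem _ hI
  rw [Finset.card_eq_sum_card_fiberwise hmaps, ← Finset.sum_fiberwise_of_maps_to hmaps,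
    Finset.mul_sum]
  apply Finset.sum_le_sum
  intro J hJ
  obtain ⟨I0, hI0, rfl⟩ := Finset.mem_image.1 hJ
  rw [mem_indsets] at hI0
  set J := φ I0 with hJdef
  have hJS : J ⊆ S := (Finset.filter_subset _ _).trans hI0.1
  have hJI : Ind G J := hI0.2.mono (Finset.filter_subset _ _)
  have hJv : ∀ u ∈ J, u ≠ v ∧ ¬ G.Adj v u := fun u hu => (Finset.mem_filter.1 hu).2
  let T : Finset V := S.filter (fun u => G.Adj v u ∧ ∀ w ∈ J, ¬ G.Adj u w)
  have hTm : ∀ u ∈ T, u ∈ S ∧ G.Adj v u ∧ ∀ w ∈ J, ¬ G.Adj u w :=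
    fun u hu => Finset.mem_filter.1 hu
  have hF : (indsets G S).filter (fun I => φ I = J) =
      insert (insert v J) ((indsets G T).image (fun X => J ∪ X)) := by
    ext I
    simp only [Finset.mem_filter, Finset.mem_insert, Finset.mem_image, mem_indsets]
    constructor
    · rintro ⟨⟨hIS, hII⟩, hφ⟩
      by_cases hvI : v ∈ I
      · left
        rw [← hφ]
        ext u
        simp only [φ, Finset.mem_insert, Finset.mem_filter]
        constructor
        · intro hu
          by_cases h : u = v
          · exact Or.inl h
          · exact Or.inr ⟨hu, h, hII v hvI u hu⟩
        · rintro (rfl | h)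
          · exact hvI
          · exact h.1
      · right
        refine ⟨I.filter (fun u => G.Adj v u), ⟨?_, hII.mono (Finset.filter_subset _ _)⟩, ?_⟩
        · intro u hu
          rw [Finset.mem_filter] at hu
          refine Finset.mem_filter.2 ⟨hIS hu.1, hu.2, ?_⟩
          intro w hw
          rw [← hφ] at hw
          exact hII u hu.1 w (Finset.mem_filter.1 hw).1
        · rw [← hφ]
          ext u
          simp only [φ, Finset.mem_union, Finset.mem_filter]
          constructor
          · rintro (h | h) <;> exact h.1
          · intro hu
            by_cases h : G.Adj v u
            · exact Or.inr ⟨hu, h⟩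
            · exact Or.inl ⟨hu, fun h' => hvI (h' ▸ hu), h⟩
    · rintro (rfl | ⟨X, ⟨hXT, hXI⟩, rfl⟩)
      · refine ⟨⟨Finset.insert_subset hv hJS, ?_⟩, ?_⟩
        · intro a ha b hb
          rcases Finset.mem_insert.1 ha with rfl | ha <;>
            rcases Finset.mem_insert.1 hb with rfl | hb
          · exact G.loopless.irrefl _
          · exact (hJv b hb).2
          · exact fun h => (hJv a ha).2 h.symm
          · exact hJI a ha b hb
        · ext u
          simp only [φ, Finset.mem_insert, Finset.mem_filter]
          constructor
          · rintro ⟨rfl | h, h1, h2⟩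
            · exact absurd rfl h1
            · exact h
          · intro h
            exact ⟨Or.inr h, hJv u h⟩
      · refine ⟨⟨Finset.union_subset hJS (hXT.trans (Finset.filter_subset _ _)), ?_⟩, ?_⟩
        · intro a ha b hb
          rcases Finset.mem_union.1 ha with ha | ha <;>
            rcases Finset.mem_union.1 hb with hb | hb
          · exact hJI a ha b hb
          · exact fun h => (hTm b (hXT hb)).2.2 a ha h.symm
          · exact (hTm a (hXT ha)).2.2 b hb
          · exact hXI a ha b hb
        · ext u
          simp only [φ, Finset.mem_union, Finset.mem_filter]
          constructor
          · rintro ⟨h | h, h1, h2⟩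
            · exact h
            · exact absurd (hTm u (hXT h)).2.1 h2
          · intro h
            exact ⟨Or.inl h, hJv u h⟩
  have hdisj : ∀ X ∈ indsets G T, Disjoint J X := by
    intro X hX
    rw [Finset.disjoint_left]
    intro u hu hu'
    exact (hJv u hu).2 (hTm u ((mem_indsets.1 hX).1 hu')).2.1
  have hinj : Set.InjOn (fun X => J ∪ X) (indsets G T : Set (Finset V)) := by
    intro X hX Y hY h
    have h1 := Finset.union_sdiff_cancel_left (hdisj X hX)
    have h2 := Finset.union_sdiff_cancel_left (hdisj Y hY)
    simp only at h
    rw [← h1, ← h2, h]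
  have hvn : insert v J ∉ (indsets G T).image (fun X => J ∪ X) := by
    intro h
    obtain ⟨X, hX, h⟩ := Finset.mem_image.1 h
    have : v ∈ J ∪ X := h ▸ Finset.mem_insert_self _ _
    rcases Finset.mem_union.1 this with h | h
    · exact (hJv v h).1 rfl
    · exact G.loopless.irrefl _ (hTm v ((mem_indsets.1 hX).1 h)).2.1
  rw [hF, Finset.card_insert_of_notMem hvn, Finset.sum_insert hvn, Finset.sum_image hinj,
    Finset.card_image_of_injOn hinj, add_comm _ 1]
  refine (hC T).trans ?_
  apply Nat.add_le_add
  · simp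
  · apply Finset.sum_le_sum
    intro X hX
    refine le_trans ?_ (Nat.le_add_left _ _)
    apply Finset.card_le_card
    intro u hu
    exact Finset.mem_filter.2 ⟨Finset.mem_union_right _ hu,
      (hTm u ((mem_indsets.1 hX).1 hu)).2.1⟩

/-- `K_r`-free graphs of bounded degree have large independent sets. -/
lemma large_indset (k r : ℕ) : ∃ C : ℕ, ∀ (V : Type) (G : SimpleGraph V), G.CliqueFree r →
    ∀ (S : Finset V) (D : ℕ), (∀ v ∈ S, dg G v S ≤ D) →
      ∃ I ⊆ S, Ind G I ∧ k * S.card ≤ (C + D) * I.card := by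
  obtain ⟨C, hC⟩ := avg_indset k r
  refine ⟨C, fun V G hG S D hD => ?_⟩
  have h1 : ∑ v ∈ S, k * (indsets G S).card ≤
      ∑ v ∈ S, ∑ I ∈ indsets G S, ((if v ∈ I then C else 0) + dg G v I) :=
    Finset.sum_le_sum (fun v hv => local_indset G k C (hC V G hG) S v hv)
  rw [Finset.sum_comm] at h1
  have h2 : ∑ I ∈ indsets G S, ∑ v ∈ S, ((if v ∈ I then C else 0) + dg G v I) ≤
      ∑ I ∈ indsets G S, (C + D) * I.card := by
    apply Finset.sum_le_sum
    intro I hI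
    have hI' := mem_indsets.1 hI
    rw [Finset.sum_add_distrib, dg_comm, add_mul]
    apply Nat.add_le_add
    · rw [← Finset.sum_filter, Finset.sum_const, smul_eq_mul, mul_comm,
        Finset.filter_mem_eq_inter, Finset.inter_eq_right.2 hI'.1]
    · rw [mul_comm, ← smul_eq_mul]
      exact Finset.sum_le_card_nsmul _ _ _ (fun u hu => hD u (hI'.1 hu))
  have h3 : ∑ I ∈ indsets G S, k * S.card ≤ ∑ I ∈ indsets G S, (C + D) * I.card := by
    refine le_trans (le_of_eq ?_) (h1.trans h2)
    simp only [Finset.sum_const, smul_eq_mul]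
    ring
  obtain ⟨I, hI, h⟩ := Finset.exists_le_of_sum_le ⟨∅, by simp [mem_indsets, Ind]⟩ h3
  exact ⟨I, (mem_indsets.1 hI).1, (mem_indsets.1 hI).2, h⟩

/-- A dense pair of disjoint independent sets. -/
def Good {V : Type} (G : SimpleGraph V) (k : ℕ) : Prop :=
  ∃ A B : Finset V, Ind G A ∧ Ind G B ∧ Disjoint A B ∧ (A ∪ B).Nonempty ∧
    k * (A.card + B.card) ≤ ∑ a ∈ A, dg G a B

lemma sum_dg_erase {V : Type} (G : SimpleGraph V) (S : Finset V) (v : V) (hv : v ∈ S) :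
    ∑ u ∈ S, dg G u S ≤ ∑ u ∈ S.erase v, dg G u (S.erase v) + 2 * dg G v S := by
  have h1 := Finset.add_sum_erase S (fun u => dg G u S) hv
  have h2 := dg_comm G (S.erase v) S
  have h3 := Finset.add_sum_erase S (fun u => dg G u (S.erase v)) hv
  have h4 := dg_mono G v (Finset.erase_subset v S)
  omega

lemma exists_core {V : Type} (G : SimpleGraph V) (k : ℕ) (S : Finset V) :
    S.Nonempty → 2 * k * S.card ≤ ∑ v ∈ S, dg G v S →
      ∃ T ⊆ S, T.Nonempty ∧ ∀ v ∈ T, k ≤ dg G v T := by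
  induction S using Finset.strongInduction with
  | H S ih =>
    intro hne hS
    by_cases hall : ∀ v ∈ S, k ≤ dg G v S
    · exact ⟨S, subset_rfl, hne, hall⟩
    push Not at hall
    obtain ⟨v, hv, hlt⟩ := hall
    have h1 := sum_dg_erase G S v hv
    have h2 := Finset.card_erase_add_one hv
    rw [← h2] at hS
    have h3 : 2 * k * (S.erase v).card < ∑ u ∈ S.erase v, dg G u (S.erase v) := by
      rw [mul_add] at hS
      omega
    have hne' : (S.erase v).Nonempty := by
      by_contra hcon
      rw [Finset.not_nonempty_iff_eq_empty] at hcon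
      rw [hcon] at h3
      simp at h3
    obtain ⟨T, hT, h⟩ := ih _ (Finset.erase_ssubset hv) hne' h3.le
    exact ⟨T, hT.trans (Finset.erase_subset _ _), h⟩

lemma finish {V : Type} [Fintype V] (G : SimpleGraph V) (k : ℕ) (T A B : Finset V)
    (hne : T.Nonempty) (hT : ∀ v ∈ T, k ≤ dg G v T) (hAB : T ⊆ A ∪ B) (hA : Ind G A)
    (hB : Ind G B) :
    ∃ s : Set V, s.Nonempty ∧ (k ≤ minDeg (G.induce s) ∧ Bip (G.induce s)) := by
  obtain ⟨s, hs⟩ : ∃ s : Set V, ∀ v, v ∈ s ↔ v ∈ T := ⟨(T : Set V), by simp⟩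
  refine ⟨s, hne.imp (fun v hv => (hs v).2 hv), ?_, ?_⟩
  · unfold minDeg
    obtain ⟨t, ht⟩ := hne
    have : Nonempty s := ⟨⟨t, (hs t).2 ht⟩⟩
    apply SimpleGraph.le_minDegree_of_forall_le_degree
    rintro ⟨v, hv⟩
    have hv' : v ∈ T := (hs v).1 hv
    refine (hT v hv').trans ?_
    rw [← SimpleGraph.card_neighborFinset_eq_degree]
    refine le_trans ?_ (Finset.card_image_le (f := Subtype.val))
    apply Finset.card_le_card
    intro u hu
    rw [Finset.mem_filter] at hu
    rw [Finset.mem_image]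
    exact ⟨⟨u, (hs u).2 hu.1⟩, by simpa using hu.2, rfl⟩
  · refine ⟨{x | (x : V) ∈ A}, ?_⟩
    rintro ⟨a, ha⟩ ⟨b, hb⟩ hadj
    have hadj' : G.Adj a b := by simpa using hadj
    simp only [Set.mem_ofPred_eq]
    have ha' := Finset.mem_union.1 (hAB ((hs a).1 ha))
    have hb' := Finset.mem_union.1 (hAB ((hs b).1 hb))
    constructor
    · exact fun h h' => hA a h b h' hadj'
    · intro h
      rcases ha' with h1 | h1
      · exact h1
      · rcases hb' with h2 | h2
        · exact absurd h2 h
        · exact absurd hadj' (hB a h1 b h2)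

lemma Good.finish {V : Type} [Fintype V] {G : SimpleGraph V} {k : ℕ} (h : Good G k) :
    ∃ s : Set V, s.Nonempty ∧ (k ≤ minDeg (G.induce s) ∧ Bip (G.induce s)) := by
  obtain ⟨A, B, hA, hB, hd, hne, hk⟩ := h
  have h1 : 2 * k * (A ∪ B).card ≤ ∑ v ∈ A ∪ B, dg G v (A ∪ B) := by
    rw [Finset.card_union_of_disjoint hd, Finset.sum_union hd]
    have e1 : ∑ a ∈ A, dg G a B ≤ ∑ a ∈ A, dg G a (A ∪ B) :=
      Finset.sum_le_sum (fun a _ => dg_mono G a Finset.subset_union_right)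
    have e2 : ∑ a ∈ B, dg G a A ≤ ∑ a ∈ B, dg G a (A ∪ B) :=
      Finset.sum_le_sum (fun a _ => dg_mono G a Finset.subset_union_left)
    have e3 := dg_comm G A B
    rw [mul_assoc]
    omega
  obtain ⟨T, hT, hTne, hTd⟩ := exists_core G k _ hne h1
  exact _root_.finish G k T A B hTne hTd hT hA hB

lemma partial_color {V : Type} (G : SimpleGraph V) (L : Finset V) (s t : ℝ)
    (h : ∀ U ⊆ L, t ≤ (U.card : ℝ) → ∃ I ⊆ U, Ind G I ∧ s ≤ (I.card : ℝ)) (m : ℕ) :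
    ∃ U ⊆ L, ∃ col : V → ℕ, (∀ v ∈ L \ U, col v < m) ∧
      (∀ i, Ind G ((L \ U).filter (fun v => col v = i))) ∧
      ((U.card : ℝ) < t ∨ m * s ≤ ((L \ U).card : ℝ)) := by
  induction m with
  | zero =>
    refine ⟨L, subset_rfl, fun _ => 0, by simp, ?_, by simp⟩
    intro i
    simp [Ind]
  | succ m ih =>
    obtain ⟨U, hU, col, hcol, hind, hor⟩ := ih
    by_cases ht : (U.card : ℝ) < t
    · exact ⟨U, hU, col, fun v hv => (hcol v hv).trans (Nat.lt_succ_self _), hind, Or.inl ht⟩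
    have hor' := hor.resolve_left ht
    push Not at ht
    obtain ⟨I, hIU, hI, hIs⟩ := h U hU ht
    have key : ∀ v, v ∈ L \ (U \ I) ↔ (v ∈ L \ U ∨ v ∈ I) := by
      intro v
      simp only [Finset.mem_sdiff]
      constructor
      · rintro ⟨h1, h2⟩
        by_cases hI : v ∈ I
        · exact Or.inr hI
        · exact Or.inl ⟨h1, fun h3 => h2 ⟨h3, hI⟩⟩
      · rintro (h1 | h1)
        · exact ⟨h1.1, fun h2 => h1.2 h2.1⟩
        · exact ⟨hU (hIU h1), fun h2 => h2.2 h1⟩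
    refine ⟨U \ I, Finset.sdiff_subset.trans hU, fun v => if v ∈ I then m else col v, ?_, ?_, ?_⟩
    · intro v hv
      by_cases hvI : v ∈ I
      · simp [hvI]
      · have := hcol v (((key v).1 hv).resolve_right hvI)
        simp only [hvI, if_false]
        omega
    · intro i
      by_cases hi : i = m
      · apply hI.mono
        intro v hv
        rw [Finset.mem_filter] at hv
        by_contra hvI
        have h1 := hcol v (((key v).1 hv.1).resolve_right hvI)
        have h2 := hv.2
        simp only [hvI, if_false] at h2
        omega
      · apply (hind i).mono
        intro v hv
        rw [Finset.mem_filter] at hv ⊢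
        have h2 := hv.2
        by_cases hvI : v ∈ I
        · simp only [hvI, if_true] at h2
          omega
        · simp only [hvI, if_false] at h2
          exact ⟨((key v).1 hv.1).resolve_right hvI, h2⟩
    · right
      have e : L \ (U \ I) = (L \ U) ∪ I := by
        ext v
        rw [key, Finset.mem_union]
      have hd : Disjoint (L \ U) I := by
        rw [Finset.disjoint_left]
        intro v h1 h2
        exact (Finset.mem_sdiff.1 h1).2 (hIU h2)
      rw [e, Finset.card_union_of_disjoint hd]
      push_cast
      linarith

lemma dg_fiber {V : Type} (G : SimpleGraph V) (W : Finset V) (col : V → ℕ) (m : ℕ)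
    (hcol : ∀ v ∈ W, col v < m) (v : V) :
    dg G v W = ∑ j ∈ Finset.range m, dg G v (W.filter (fun u => col u = j)) := by
  unfold dg
  rw [Finset.card_eq_sum_card_fiberwise (f := col) (t := Finset.range m)]
  · apply Finset.sum_congr rfl
    intro j _
    rw [Finset.filter_comm]
  · intro u hu
    simp only [Finset.coe_filter, Set.mem_ofPred_eq] at hu
    simpa using hcol u hu.1

lemma color_case {V : Type} (G : SimpleGraph V) (L : Finset V) (x K q k n : ℕ)
    (hx : 1 ≤ x) (hK : 1 ≤ K) (hn : 1 ≤ n) (hLn : L.card ≤ n)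
    (hxq : q ≤ x) (hq : 1024 * K ^ 2 * k < q)
    (hdeg : ∀ v ∈ L, dg G v L ≤ K * x)
    (hI : ∀ U ⊆ L, ∃ I ⊆ U, Ind G I ∧ q * U.card ≤ 2 * (K * x) * I.card)
    (hE : x * n ≤ 4 * ∑ v ∈ L, dg G v L) : Good G k := by
  by_contra hng
  have hxR : (1 : ℝ) ≤ x := by exact_mod_cast hx
  have hKR : (1 : ℝ) ≤ K := by exact_mod_cast hK
  have hnR : (1 : ℝ) ≤ n := by exact_mod_cast hn
  have hqR : (1 : ℝ) ≤ q := by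
    have : 1 ≤ q := by omega
    exact_mod_cast this
  have hxqR : (q : ℝ) ≤ x := by exact_mod_cast hxq
  set t : ℝ := n / (16 * K) with ht
  set s : ℝ := q * n / (32 * K ^ 2 * x) with hs
  have hspos : 0 < s := by positivity
  have hcond : ∀ U ⊆ L, t ≤ (U.card : ℝ) → ∃ I ⊆ U, Ind G I ∧ s ≤ (I.card : ℝ) := by
    intro U hU hUt
    obtain ⟨I, hIU, hII, hIc⟩ := hI U hU
    refine ⟨I, hIU, hII, ?_⟩
    have hIc' : (q : ℝ) * U.card ≤ 2 * (K * x) * I.card := by exact_mod_cast hIc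
    rw [ht, div_le_iff₀ (by positivity)] at hUt
    rw [hs, div_le_iff₀ (by positivity)]
    calc (q : ℝ) * n ≤ q * (U.card * (16 * K)) := by gcongr
      _ = (q * U.card) * (16 * K) := by ring
      _ ≤ (2 * (K * x) * I.card) * (16 * K) := by gcongr
      _ = I.card * (32 * K ^ 2 * x) := by ring
  set m : ℕ := ⌊(n : ℝ) / s⌋₊ + 1 with hm
  have hm1 : (n : ℝ) / s < m := by
    rw [hm]; push_cast; exact Nat.lt_floor_add_one _
  have hm2 : (m : ℝ) ≤ n / s + 1 := by
    rw [hm]; push_cast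
    have := Nat.floor_le (show 0 ≤ (n : ℝ) / s by positivity)
    linarith
  have hns : (n : ℝ) / s = 32 * K ^ 2 * x / q := by
    rw [hs]; field_simp
  have hm3 : (m : ℝ) * q ≤ 64 * K ^ 2 * x := by
    rw [hns] at hm2
    have h1 : (32 * (K : ℝ) ^ 2 * x / q + 1) * q = 32 * K ^ 2 * x + q := by field_simp
    have h2 : (m : ℝ) * q ≤ (32 * (K : ℝ) ^ 2 * x / q + 1) * q := by gcongr
    have h3 : (1 : ℝ) ≤ (K : ℝ) ^ 2 := one_le_pow₀ hKR
    nlinarith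
  obtain ⟨U, hU, col, hcol, hind, hor⟩ := partial_color G L s t hcond m
  have hWL : (L \ U) ⊆ L := Finset.sdiff_subset
  have hWn : (((L \ U).card : ℕ) : ℝ) ≤ n := by
    exact_mod_cast (Finset.card_le_card hWL).trans hLn
  have hUt : (U.card : ℝ) < t := by
    rcases hor with h | h
    · exact h
    · exfalso
      rw [div_lt_iff₀ hspos] at hm1
      linarith
  set W := L \ U with hW
  -- edges inside W
  have hEW : ∑ v ∈ L, dg G v L ≤ ∑ v ∈ W, dg G v W + 2 * (U.card * (K * x)) := by
    have e1 : ∑ v ∈ L, dg G v L = ∑ v ∈ W, dg G v L + ∑ v ∈ U, dg G v L :=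
      (Finset.sum_sdiff hU).symm
    have e2 := dg_comm G W L
    have e3 : ∑ v ∈ L, dg G v W = ∑ v ∈ W, dg G v W + ∑ v ∈ U, dg G v W :=
      (Finset.sum_sdiff hU).symm
    have e4 : ∑ v ∈ U, dg G v L ≤ U.card * (K * x) := by
      rw [← smul_eq_mul]
      exact Finset.sum_le_card_nsmul _ _ _ (fun u hu => hdeg u (hU hu))
    have e5 : ∑ v ∈ U, dg G v W ≤ ∑ v ∈ U, dg G v L :=
      Finset.sum_le_sum (fun u _ => dg_mono G u hWL)
    omega
  let c : ℕ → Finset V := fun i => W.filter (fun v => col v = i)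
  have hpair : ∀ i j, ∑ v ∈ c i, dg G v (c j) ≤ k * ((c i).card + (c j).card) := by
    intro i j
    by_contra hcon
    push Not at hcon
    have hij : i ≠ j := by
      rintro rfl
      have : ∑ v ∈ c i, dg G v (c i) = 0 := by
        apply Finset.sum_eq_zero
        intro v hv
        unfold dg
        rw [Finset.card_eq_zero, Finset.filter_eq_empty_iff]
        intro u hu
        exact hind i v hv u hu
      omega
    apply hng
    refine ⟨c i, c j, hind i, hind j, ?_, ?_, hcon.le⟩
    · rw [Finset.disjoint_left]
      intro v h1 h2
      exact hij ((Finset.mem_filter.1 h1).2.symm.trans (Finset.mem_filter.1 h2).2)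
    · by_contra hcon2
      rw [Finset.not_nonempty_iff_eq_empty, Finset.union_eq_empty] at hcon2
      rw [hcon2.1] at hcon
      simp at hcon
  have hcard : ∑ i ∈ Finset.range m, (c i).card = W.card := by
    symm
    apply Finset.card_eq_sum_card_fiberwise
    intro v hv
    simpa using hcol v hv
  have hsum : ∑ v ∈ W, dg G v W = ∑ i ∈ Finset.range m, ∑ j ∈ Finset.range m,
      ∑ v ∈ c i, dg G v (c j) := by
    rw [← Finset.sum_fiberwise_of_maps_to (s := W) (t := Finset.range m) (g := col)
      (fun v hv => by simpa using hcol v hv)]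
    apply Finset.sum_congr rfl
    intro i _
    rw [Finset.sum_comm]
    apply Finset.sum_congr rfl
    intro v _
    exact dg_fiber G W col m hcol v
  have hupper : ∑ v ∈ W, dg G v W ≤ k * (2 * (m * W.card)) := by
    rw [hsum]
    calc _ ≤ ∑ i ∈ Finset.range m, ∑ j ∈ Finset.range m, k * ((c i).card + (c j).card) :=
          Finset.sum_le_sum (fun i _ => Finset.sum_le_sum (fun j _ => hpair i j))
      _ = k * (2 * (m * W.card)) := by
          simp only [← Finset.mul_sum, Finset.sum_add_distrib, hcard, Finset.sum_const,
            Finset.card_range, smul_eq_mul]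
          ring
  have hupR : ((∑ v ∈ W, dg G v W : ℕ) : ℝ) ≤ k * (2 * (m * n)) := by
    have : ((∑ v ∈ W, dg G v W : ℕ) : ℝ) ≤ ((k * (2 * (m * W.card)) : ℕ) : ℝ) := by
      exact_mod_cast hupper
    refine this.trans ?_
    push_cast
    gcongr
  have hER : (x : ℝ) * n ≤ 4 * ((∑ v ∈ L, dg G v L : ℕ) : ℝ) := by exact_mod_cast hE
  have hEWR : ((∑ v ∈ L, dg G v L : ℕ) : ℝ) ≤ ((∑ v ∈ W, dg G v W : ℕ) : ℝ)
      + 2 * (U.card * (K * x)) := by exact_mod_cast hEW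
  have hUK : (U.card : ℝ) * (16 * K) ≤ n := by
    rw [ht, lt_div_iff₀ (by positivity)] at hUt
    exact hUt.le
  have hUKx : (U.card : ℝ) * (K * x) * 16 ≤ n * x := by
    calc _ = (U.card : ℝ) * (16 * K) * x := by ring
      _ ≤ n * x := by gcongr
  -- conclude
  have hfin : (x : ℝ) * n ≤ 16 * (k * (m * n)) := by linarith
  have hfin2 : (x : ℝ) ≤ 16 * k * m := by
    have : (x : ℝ) * n ≤ (16 * k * m) * n := by linarith
    exact le_of_mul_le_mul_right this (by linarith)
  have hqk : (1024 * (K : ℝ) ^ 2 * k) < q := by exact_mod_cast hq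
  have h1 : (x : ℝ) * q ≤ 16 * k * (64 * K ^ 2 * x) := by
    calc (x : ℝ) * q ≤ (16 * k * m) * q := by gcongr
      _ = 16 * k * (m * q) := by ring
      _ ≤ _ := by gcongr
  have h2 : (x : ℝ) * q ≤ x * (1024 * K ^ 2 * k) := by linarith
  have h3 := le_of_mul_le_mul_left h2 (by linarith)
  linarith

lemma prod_helper {V : Type} [Fintype V] (M : ℕ) (W Z : Finset V) (hd : Disjoint W Z) :
    (∏ v : V, (if v ∈ W then 1 else if v ∈ Z then M - 2 else M)) * M ^ W.card * M ^ Z.card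
      = (M - 2) ^ Z.card * M ^ Fintype.card V := by
  have h1 : ∏ v : V, (if v ∈ W then M else 1) = M ^ W.card := by
    rw [Finset.prod_ite_mem, Finset.univ_inter, Finset.prod_const]
  have h2 : ∏ v : V, (if v ∈ Z then M else 1) = M ^ Z.card := by
    rw [Finset.prod_ite_mem, Finset.univ_inter, Finset.prod_const]
  have h3 : ∏ v : V, (if v ∈ Z then M - 2 else 1) = (M - 2) ^ Z.card := by
    rw [Finset.prod_ite_mem, Finset.univ_inter, Finset.prod_const]
  have h4 : ∏ _v : V, M = M ^ Fintype.card V := by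
    rw [Finset.prod_const, Finset.card_univ]
  rw [← h1, ← h2, ← h3, ← h4, ← Finset.prod_mul_distrib, ← Finset.prod_mul_distrib,
    ← Finset.prod_mul_distrib]
  apply Finset.prod_congr rfl
  intro v _
  by_cases hW : v ∈ W
  · have hZ : v ∉ Z := Finset.disjoint_left.1 hd hW
    simp [hW, hZ]
  · by_cases hZ : v ∈ Z <;> simp [hW, hZ]

lemma bern (M z : ℕ) (hM : 4 * z ≤ M) (hM2 : 2 ≤ M) : M ^ z ≤ 2 * (M - 2) ^ z := by
  have hMp : (0 : ℝ) < M := by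
    have : 0 < M := by omega
    exact_mod_cast this
  have h2M : (2 : ℝ) / M ≤ 1 := by
    rw [div_le_one hMp]; exact_mod_cast hM2
  have h := one_add_mul_le_pow (a := -(2 / (M : ℝ))) (by linarith) z
  have h4 : (4 : ℝ) * z ≤ M := by exact_mod_cast hM
  have h5 : (z : ℝ) * (2 / M) ≤ 1 / 2 := by
    rw [mul_div_assoc', div_le_iff₀ hMp]; linarith
  have h6 : (1 : ℝ) / 2 ≤ (1 + -(2 / (M : ℝ))) ^ z := by linarith
  have h7 : ((M : ℝ) - 2) = M * (1 + -(2 / (M : ℝ))) := by field_simp; ring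
  have h8 : (M : ℝ) ^ z ≤ 2 * ((M : ℝ) - 2) ^ z := by
    rw [h7, mul_pow]
    have : (0 : ℝ) < (M : ℝ) ^ z := by positivity
    nlinarith
  have h9 : ((M - 2 : ℕ) : ℝ) = (M : ℝ) - 2 := by
    rw [Nat.cast_sub hM2]; norm_num
  rw [← h9] at h8
  exact_mod_cast h8

/-- The random independent set selected by a labelling `c`. -/
def sel {V : Type} (G : SimpleGraph V) (B : Finset V) (out : V → Finset V) (c : V → ℕ) :
    Finset V :=
  B.filter (fun b => c b = 0 ∧ ∀ w ∈ B, G.Adj b w → w ∈ out b → c w ≠ 0)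

lemma mem_sel {V : Type} {G : SimpleGraph V} {B : Finset V} {out : V → Finset V} {c : V → ℕ}
    {b : V} : b ∈ sel G B out c ↔
      b ∈ B ∧ c b = 0 ∧ ∀ w ∈ B, G.Adj b w → w ∈ out b → c w ≠ 0 := by
  unfold sel
  rw [Finset.mem_filter]

lemma sel_ind {V : Type} (G : SimpleGraph V) (B : Finset V) (out : V → Finset V) (c : V → ℕ)
    (hout : ∀ u ∈ B, ∀ v ∈ B, G.Adj u v → v ∈ out u ∨ u ∈ out v) :
    Ind G (sel G B out c) := by
  intro u hu v hv hadj
  obtain ⟨huB, hu0, hu1⟩ := mem_sel.1 hu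
  obtain ⟨hvB, hv0, hv1⟩ := mem_sel.1 hv
  rcases hout u huB v hvB hadj with h | h
  · exact hu1 v hvB hadj h hv0
  · exact hv1 u huB hadj.symm h hu0

/-- Labellings with values in `{0, …, M - 1}`. -/
def lab (V : Type) [Fintype V] (M : ℕ) : Finset (V → ℕ) :=
  Fintype.piFinset (fun _ : V => Finset.range M)

lemma card_lab (V : Type) [Fintype V] (M : ℕ) : (lab V M).card = M ^ Fintype.card V := by
  simp [lab]

lemma count_zero {V : Type} [Fintype V] (M : ℕ) (b : V) :
    ((lab V M).filter (fun c => c b = 0)).card * M ≤ M ^ Fintype.card V := by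
  have h := prod_helper M {b} (∅ : Finset V) (by simp)
  simp only [Finset.card_singleton, pow_one, Finset.card_empty, pow_zero, mul_one, one_mul] at h
  rw [← h]
  apply Nat.mul_le_mul_right
  have : (lab V M).filter (fun c => c b = 0) ⊆
      Fintype.piFinset (fun v : V => if v = b then {0} else Finset.range M) := by
    intro c hc
    rw [Finset.mem_filter] at hc
    rw [Fintype.mem_piFinset]
    intro v
    by_cases hv : v = b
    · subst hv; simp [hc.2]
    · simp only [hv, if_false]
      exact Fintype.mem_piFinset.1 hc.1 v
  refine (Finset.card_le_card this).trans ?_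
  rw [Fintype.card_piFinset]
  apply le_of_eq
  apply Finset.prod_congr rfl
  intro v _
  by_cases hv : v = b <;> simp [hv]

lemma count_event {V : Type} [Fintype V] (G : SimpleGraph V) (m r x M : ℕ) (hm : 1 ≤ m)
    (hG : G.CliqueFree r) (B : Finset V) (out : V → Finset V)
    (hout : ∀ v ∈ B, (out v).card ≤ x)
    (D : Finset V) (hDB : D ⊆ B) (hM : 4 * (D.card + m * x) ≤ M) (hM2 : 2 ≤ M) :
    D.card.choose (m ^ r) * M ^ Fintype.card V ≤
      2 * M ^ (m ^ r) *
        ((lab V M).filter (fun c => m ≤ (D ∩ sel G B out c).card)).card := by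
  have hY : ∀ W : Finset V, ∃ Y : Finset V, W ∈ D.powersetCard (m ^ r) →
      Y ⊆ W ∧ Ind G Y ∧ Y.card = m := by
    intro W
    by_cases hW : W ∈ D.powersetCard (m ^ r)
    · rw [Finset.mem_powersetCard] at hW
      rcases ramsey_poly G m hm r W hW.2.ge with ⟨Q, _, hQ⟩ | ⟨I, h1, h2, h3⟩
      · exact absurd hQ (hG Q)
      · exact ⟨I, fun _ => ⟨h1, h2, h3⟩⟩
    · exact ⟨∅, fun h => absurd h hW⟩
  choose Y hY using hY
  let Z : Finset V → Finset V := fun W => (D ∪ (Y W).biUnion out) \ W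
  let F : Finset V → Finset (V → ℕ) := fun W => Fintype.piFinset (fun v : V =>
    if v ∈ W then (if v ∈ Y W then {0} else {1}) else
      if v ∈ Z W then Finset.Ico 2 M else Finset.range M)
  have hF0 : ∀ W ∈ D.powersetCard (m ^ r), ∀ c ∈ F W, ∀ v ∈ Y W, c v = 0 := by
    intro W hW c hc v hv
    have h := Fintype.mem_piFinset.1 hc v
    simpa [(hY W hW).1 hv, hv] using h
  have hF1 : ∀ W, ∀ c ∈ F W, ∀ v ∈ W, c v < 2 := by
    intro W c hc v hv
    have h := Fintype.mem_piFinset.1 hc v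
    by_cases hvY : v ∈ Y W
    · simp only [hv, hvY, if_true, Finset.mem_singleton] at h; omega
    · simp only [hv, hvY, if_true, if_false, Finset.mem_singleton] at h; omega
  have hF1' : ∀ W, ∀ c ∈ F W, ∀ v ∈ W, v ∉ Y W → c v = 1 := by
    intro W c hc v hv hvY
    have h := Fintype.mem_piFinset.1 hc v
    simpa only [hv, hvY, if_true, if_false, Finset.mem_singleton] using h
  have hF2 : ∀ W, ∀ c ∈ F W, ∀ v ∈ Z W, 2 ≤ c v := by
    intro W c hc v hv
    have h := Fintype.mem_piFinset.1 hc v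
    have hvW : v ∉ W := (Finset.mem_sdiff.1 hv).2
    simp only [hvW, hv, if_true, if_false, Finset.mem_Ico] at h
    exact h.1
  have hsub : (D.powersetCard (m ^ r)).biUnion F ⊆
      (lab V M).filter (fun c => m ≤ (D ∩ sel G B out c).card) := by
    intro c hc
    obtain ⟨W, hW, hcF⟩ := Finset.mem_biUnion.1 hc
    have hWD := (Finset.mem_powersetCard.1 hW).1
    obtain ⟨hYW, hYI, hYc⟩ := hY W hW
    rw [Finset.mem_filter]
    constructor
    · refine Fintype.mem_piFinset.2 (fun v => ?_)
      have h := Fintype.mem_piFinset.1 hcF v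
      rw [Finset.mem_range]
      split_ifs at h <;> simp at h <;> omega
    · rw [← hYc]
      apply Finset.card_le_card
      intro y hy
      refine Finset.mem_inter.2 ⟨hWD (hYW hy), mem_sel.2
        ⟨hDB (hWD (hYW hy)), hF0 W hW c hcF y hy, ?_⟩⟩
      intro w _ hadj hwo
      by_cases hwW : w ∈ W
      · have hwY : w ∉ Y W := fun h => hYI y hy w h hadj
        rw [hF1' W c hcF w hwW hwY]
        norm_num
      · have : w ∈ Z W := Finset.mem_sdiff.2
          ⟨Finset.mem_union_right _ (Finset.mem_biUnion.2 ⟨y, hy, hwo⟩), hwW⟩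
        have := hF2 W c hcF w this
        omega
  have hdisj : ∀ W ∈ D.powersetCard (m ^ r), ∀ W' ∈ D.powersetCard (m ^ r), W ≠ W' →
      Disjoint (F W) (F W') := by
    intro W hW W' hW' hne
    rw [Finset.disjoint_left]
    intro c hc hc'
    apply hne
    have rec1 : ∀ W ∈ D.powersetCard (m ^ r), c ∈ F W → W = D.filter (fun v => c v < 2) := by
      intro W hW hc
      have hWD := (Finset.mem_powersetCard.1 hW).1
      ext v
      rw [Finset.mem_filter]
      constructor
      · exact fun hv => ⟨hWD hv, hF1 W c hc v hv⟩
      · rintro ⟨hvD, hv2⟩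
        by_contra hvW
        have := hF2 W c hc v (Finset.mem_sdiff.2 ⟨Finset.mem_union_left _ hvD, hvW⟩)
        omega
    rw [rec1 W hW hc, ← rec1 W' hW' hc']
  have hcardF : ∀ W ∈ D.powersetCard (m ^ r),
      M ^ Fintype.card V ≤ 2 * M ^ (m ^ r) * (F W).card := by
    intro W hW
    obtain ⟨hWD, hWc⟩ := Finset.mem_powersetCard.1 hW
    obtain ⟨hYW, hYI, hYc⟩ := hY W hW
    have hd : Disjoint W (Z W) := Finset.disjoint_sdiff
    have h1 := prod_helper M W (Z W) hd
    have h2 : (F W).card = ∏ v : V, (if v ∈ W then 1 else if v ∈ Z W then M - 2 else M) := by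
      rw [Fintype.card_piFinset]
      apply Finset.prod_congr rfl
      intro v _
      split_ifs <;> simp
    rw [← h2, hWc] at h1
    have hz : (Z W).card ≤ D.card + m * x := by
      refine (Finset.card_le_card Finset.sdiff_subset).trans
        ((Finset.card_union_le _ _).trans (Nat.add_le_add_left ?_ _))
      rw [← hYc]
      exact Finset.card_biUnion_le_card_mul _ _ _ (fun y hy => hout y (hDB (hWD (hYW hy))))
    have h3 := bern M (Z W).card (by omega) hM2
    have hpos : 0 < M ^ (Z W).card := Nat.pow_pos (by omega)
    refine Nat.le_of_mul_le_mul_right ?_ hpos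
    calc M ^ Fintype.card V * M ^ (Z W).card
        ≤ M ^ Fintype.card V * (2 * (M - 2) ^ (Z W).card) := Nat.mul_le_mul_left _ h3
      _ = 2 * ((M - 2) ^ (Z W).card * M ^ Fintype.card V) := by ring
      _ = 2 * ((F W).card * M ^ m ^ r * M ^ (Z W).card) := by rw [h1]
      _ = 2 * M ^ (m ^ r) * (F W).card * M ^ (Z W).card := by ring
  calc D.card.choose (m ^ r) * M ^ Fintype.card V
      = ∑ W ∈ D.powersetCard (m ^ r), M ^ Fintype.card V := by
        rw [Finset.sum_const, Finset.card_powersetCard, smul_eq_mul]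
    _ ≤ ∑ W ∈ D.powersetCard (m ^ r), 2 * M ^ (m ^ r) * (F W).card := Finset.sum_le_sum hcardF
    _ = 2 * M ^ (m ^ r) * ((D.powersetCard (m ^ r)).biUnion F).card := by
        rw [Finset.card_biUnion hdisj, Finset.mul_sum]
    _ ≤ _ := Nat.mul_le_mul_left _ (Finset.card_le_card hsub)

/-- `out` orients all edges inside `T`, with out-degrees at most `x`. -/
def Orients {V : Type} (G : SimpleGraph V) (T : Finset V) (x : ℕ) (out : V → Finset V) : Prop :=
  (∀ v ∈ T, (out v).card ≤ x) ∧ ∀ u ∈ T, ∀ v ∈ T, G.Adj u v → v ∈ out u ∨ u ∈ out v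

lemma Orients.mono {V : Type} {G : SimpleGraph V} {S T : Finset V} {x : ℕ} {out : V → Finset V}
    (h : Orients G T x out) (hs : S ⊆ T) : Orients G S x out :=
  ⟨fun v hv => h.1 v (hs hv), fun u hu v hv => h.2 u (hs hu) v (hs hv)⟩

lemma Orients.sum_le {V : Type} {G : SimpleGraph V} {T : Finset V} {x : ℕ} {out : V → Finset V}
    (h : Orients G T x out) : ∑ v ∈ T, dg G v T ≤ 2 * x * T.card := by
  have h1 : ∀ v ∈ T, dg G v T ≤ (T.filter (fun u => u ∈ out v)).card
      + (T.filter (fun u => v ∈ out u)).card := by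
    intro v hv
    refine le_trans (Finset.card_le_card ?_) (Finset.card_union_le _ _)
    intro u hu
    rw [Finset.mem_filter] at hu
    rw [Finset.mem_union, Finset.mem_filter, Finset.mem_filter]
    rcases h.2 v hv u hu.1 hu.2 with h' | h'
    · exact Or.inl ⟨hu.1, h'⟩
    · exact Or.inr ⟨hu.1, h'⟩
  have h2 : ∑ v ∈ T, (T.filter (fun u => u ∈ out v)).card ≤ T.card * x := by
    rw [← smul_eq_mul]
    apply Finset.sum_le_card_nsmul
    intro v hv
    refine le_trans (Finset.card_le_card ?_) (h.1 v hv)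
    intro u hu
    exact (Finset.mem_filter.1 hu).2
  have h3 : ∑ v ∈ T, (T.filter (fun u => v ∈ out u)).card
      = ∑ v ∈ T, (T.filter (fun u => u ∈ out v)).card := by
    simp only [Finset.card_filter]
    rw [Finset.sum_comm]
  have h4 := Finset.sum_le_sum h1
  rw [Finset.sum_add_distrib, h3] at h4
  nlinarith

lemma Orients.indset {V : Type} {G : SimpleGraph V} {x : ℕ} {out : V → Finset V}
    (T : Finset V) : Orients G T x out → ∃ I ⊆ T, Ind G I ∧ T.card ≤ (2 * x + 1) * I.card := by
  induction T using Finset.strongInduction with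
  | H T ih =>
    intro h
    rcases T.eq_empty_or_nonempty with rfl | hne
    · exact ⟨∅, by simp, by simp [Ind], by simp⟩
    have h1 : ∑ v ∈ T, dg G v T ≤ ∑ v ∈ T, 2 * x := by
      rw [Finset.sum_const, smul_eq_mul, mul_comm T.card]
      exact h.sum_le
    obtain ⟨v, hv, hvd⟩ := Finset.exists_le_of_sum_le hne h1
    let T' := T.filter (fun u => u ≠ v ∧ ¬ G.Adj v u)
    have hT' : T' ⊂ T := by
      refine (Finset.ssubset_iff_of_subset (Finset.filter_subset _ _)).2 ⟨v, hv, ?_⟩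
      simp
    obtain ⟨I, hI, hInd, hIc⟩ := ih T' hT' (h.mono hT'.1)
    have hvI : v ∉ I := fun hh => (Finset.mem_filter.1 (hI hh)).2.1 rfl
    refine ⟨insert v I, Finset.insert_subset hv (hI.trans hT'.1), ?_, ?_⟩
    · intro a ha b hb
      rcases Finset.mem_insert.1 ha with ha1 | ha1 <;>
        rcases Finset.mem_insert.1 hb with hb1 | hb1
      · rw [ha1, hb1]; exact G.loopless.irrefl _
      · rw [ha1]; exact (Finset.mem_filter.1 (hI hb1)).2.2
      · rw [hb1]; exact fun hh => (Finset.mem_filter.1 (hI ha1)).2.2 hh.symm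
      · exact hInd a ha1 b hb1
    · rw [Finset.card_insert_of_notMem hvI]
      have hcov : T ⊆ T' ∪ insert v (T.filter (fun u => G.Adj v u)) := by
        intro u hu
        by_cases h1 : u = v
        · simp [h1]
        · by_cases h2 : G.Adj v u
          · simp [hu, h2]
          · apply Finset.mem_union_left
            exact Finset.mem_filter.2 ⟨hu, h1, h2⟩
      have h2 := (Finset.card_le_card hcov).trans (Finset.card_union_le _ _)
      have h3 := Finset.card_insert_le v (T.filter (fun u => G.Adj v u))
      unfold dg at hvd
      rw [mul_add]
      omega

lemma choose_bound (x R : ℕ) (hx : 4 * R ≤ x) :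
    x ^ R ≤ 4 ^ R * R.factorial * ((x + 1) / 2).choose R := by
  have h1 := Nat.pow_sub_le_descFactorial ((x + 1) / 2) R
  rw [Nat.descFactorial_eq_factorial_mul_choose] at h1
  have h2 : x ≤ 4 * ((x + 1) / 2 + 1 - R) := by omega
  calc x ^ R ≤ (4 * ((x + 1) / 2 + 1 - R)) ^ R := Nat.pow_le_pow_left h2 _
    _ = 4 ^ R * ((x + 1) / 2 + 1 - R) ^ R := mul_pow _ _ _
    _ ≤ 4 ^ R * (R.factorial * ((x + 1) / 2).choose R) := Nat.mul_le_mul_left _ h1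
    _ = _ := by ring

lemma asym_case (k r : ℕ) (hk : 1 ≤ k) : ∃ P x0 : ℕ, ∀ (V : Type) [Fintype V]
    (G : SimpleGraph V), G.CliqueFree r → ∀ x ≥ x0, ∀ (A B : Finset V) (out : V → Finset V),
    Disjoint A B → Orients G (A ∪ B) x out → (∀ a ∈ A, x ≤ 2 * dg G a B) →
    P * B.card < A.card → Good G k := by
  set m := 2 * k with hm
  set R := m ^ r with hR
  set P := 2 * (4 * (m + 1)) ^ R * (4 ^ R * R.factorial) with hP
  refine ⟨P, 4 * R + 1, ?_⟩
  intro V _ G hG x hx A B out hd hor hdeg hcard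
  set M := 4 * ((m + 1) * x) with hM
  have hxM : 4 * x ≤ M := by
    rw [hM, add_mul]; omega
  have hMpos : 0 < M := by omega
  -- each vertex of A is good often
  have hA : ∀ a ∈ A, M ^ Fintype.card V ≤
      P * ((lab V M).filter (fun c => m ≤ dg G a (sel G B out c))).card := by
    intro a ha
    have h1 : (x + 1) / 2 ≤ (B.filter (fun u => G.Adj a u)).card := by
      have := hdeg a ha
      unfold dg at this
      omega
    obtain ⟨D, hD, hDc⟩ := Finset.exists_subset_card_eq h1
    have hDB : D ⊆ B := hD.trans (Finset.filter_subset _ _)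
    have hDM : 4 * (D.card + m * x) ≤ M := by
      rw [hM, hDc, add_mul]; omega
    have h2 := count_event G m r x M (by omega) hG B out
      (fun v hv => hor.1 v (Finset.mem_union_right _ hv)) D hDB hDM (by omega)
    rw [← hR, hDc] at h2
    have h3 : ((lab V M).filter (fun c => m ≤ (D ∩ sel G B out c).card)).card ≤
        ((lab V M).filter (fun c => m ≤ dg G a (sel G B out c))).card := by
      apply Finset.card_le_card
      intro c hc
      rw [Finset.mem_filter] at hc ⊢
      refine ⟨hc.1, hc.2.trans (Finset.card_le_card ?_)⟩
      intro u hu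
      rw [Finset.mem_inter] at hu
      exact Finset.mem_filter.2 ⟨hu.2, (Finset.mem_filter.1 (hD hu.1)).2⟩
    set N := ((lab V M).filter (fun c => m ≤ dg G a (sel G B out c))).card
    have h4 := choose_bound x R (by omega)
    have h5 : M ^ R = (4 * (m + 1)) ^ R * x ^ R := by
      rw [hM, ← mul_assoc, mul_pow]
    have hxR : 0 < x ^ R := Nat.pow_pos (by omega)
    refine Nat.le_of_mul_le_mul_left ?_ hxR
    calc x ^ R * M ^ Fintype.card V
        ≤ (4 ^ R * R.factorial * ((x + 1) / 2).choose R) * M ^ Fintype.card V :=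
          Nat.mul_le_mul_right _ h4
      _ = (4 ^ R * R.factorial) * (((x + 1) / 2).choose R * M ^ Fintype.card V) := by ring
      _ ≤ (4 ^ R * R.factorial) * (2 * M ^ R * N) :=
          Nat.mul_le_mul_left _ (h2.trans (Nat.mul_le_mul_left _ h3))
      _ = x ^ R * (P * N) := by rw [h5, hP]; ring
  let A' : (V → ℕ) → Finset V := fun c => A.filter (fun a => m ≤ dg G a (sel G B out c))
  have hsumA : A.card * M ^ Fintype.card V ≤ P * ∑ c ∈ lab V M, (A' c).card := by
    have e : ∑ c ∈ lab V M, (A' c).card =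
        ∑ a ∈ A, ((lab V M).filter (fun c => m ≤ dg G a (sel G B out c))).card := by
      simp only [A', Finset.card_filter]
      rw [Finset.sum_comm]
    rw [e, Finset.mul_sum, ← smul_eq_mul]
    exact Finset.card_nsmul_le_sum _ _ _ hA
  have hsumB : (∑ c ∈ lab V M, (sel G B out c).card) * M ≤ B.card * M ^ Fintype.card V := by
    have e : ∑ c ∈ lab V M, (sel G B out c).card ≤
        ∑ b ∈ B, ((lab V M).filter (fun c => c b = 0)).card := by
      have e1 : ∑ c ∈ lab V M, (sel G B out c).card ≤
          ∑ c ∈ lab V M, (B.filter (fun b => c b = 0)).card := by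
        apply Finset.sum_le_sum
        intro c _
        apply Finset.card_le_card
        intro b hb
        have := mem_sel.1 hb
        exact Finset.mem_filter.2 ⟨this.1, this.2.1⟩
      refine e1.trans (le_of_eq ?_)
      simp only [Finset.card_filter]
      rw [Finset.sum_comm]
    refine (Nat.mul_le_mul_right _ e).trans ?_
    rw [Finset.sum_mul, ← smul_eq_mul]
    exact Finset.sum_le_card_nsmul _ _ _ (fun b _ => count_zero M b)
  have hex : ∃ c, (2 * x + 1) * (sel G B out c).card < (A' c).card := by
    by_contra hcon
    push Not at hcon
    have h1 : ∑ c ∈ lab V M, (A' c).card ≤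
        (2 * x + 1) * ∑ c ∈ lab V M, (sel G B out c).card := by
      rw [Finset.mul_sum]
      exact Finset.sum_le_sum (fun c _ => hcon c)
    have hpos : 0 < M ^ Fintype.card V * M := by positivity
    have h2 : A.card * (M ^ Fintype.card V * M) ≤ P * B.card * (M ^ Fintype.card V * M) := by
      calc A.card * (M ^ Fintype.card V * M) = (A.card * M ^ Fintype.card V) * M := by ring
        _ ≤ (P * ((2 * x + 1) * ∑ c ∈ lab V M, (sel G B out c).card)) * M :=
            Nat.mul_le_mul_right _ (hsumA.trans (Nat.mul_le_mul_left _ h1))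
        _ = P * (2 * x + 1) * ((∑ c ∈ lab V M, (sel G B out c).card) * M) := by ring
        _ ≤ P * M * (B.card * M ^ Fintype.card V) :=
            Nat.mul_le_mul (Nat.mul_le_mul_left _ (by omega)) hsumB
        _ = _ := by ring
    have := Nat.le_of_mul_le_mul_right h2 hpos
    omega
  obtain ⟨c, hc⟩ := hex
  have hA'A : A' c ⊆ A := Finset.filter_subset _ _
  have hsB : sel G B out c ⊆ B := fun b hb => (mem_sel.1 hb).1
  obtain ⟨I, hIA, hInd, hIc⟩ := Orients.indset (A' c)
    (hor.mono (hA'A.trans Finset.subset_union_left))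
  have hlt : (sel G B out c).card < I.card :=
    Nat.lt_of_mul_lt_mul_left (lt_of_lt_of_le hc hIc)
  refine ⟨I, sel G B out c, hInd, sel_ind G B out c (hor.mono Finset.subset_union_right).2,
    Finset.disjoint_of_subset_left (hIA.trans hA'A) (Finset.disjoint_of_subset_right hsB hd),
    ?_, ?_⟩
  · have : I.Nonempty := Finset.card_pos.1 (by omega)
    exact this.mono Finset.subset_union_left
  · have h1 : I.card * m ≤ ∑ a ∈ I, dg G a (sel G B out c) := by
      rw [← smul_eq_mul]
      exact Finset.card_nsmul_le_sum _ _ _ (fun a ha => (Finset.mem_filter.1 (hIA ha)).2)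
    refine le_trans ?_ h1
    rw [hm]
    nlinarith

lemma degenerate_orients {V : Type} (G : SimpleGraph V) (x : ℕ) (hx : 1 ≤ x) (U : Finset V) :
    (∀ S ⊆ U, S.Nonempty → ∃ v ∈ S, dg G v S < x) → ∃ out, Orients G U (x - 1) out := by
  induction U using Finset.strongInduction with
  | H U ih =>
    intro h
    rcases U.eq_empty_or_nonempty with rfl | hne
    · exact ⟨fun _ => ∅, by simp, by simp⟩
    obtain ⟨v, hv, hvd⟩ := h U subset_rfl hne
    obtain ⟨out, ho⟩ := ih (U.erase v) (Finset.erase_ssubset hv)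
      (fun S hS => h S (hS.trans (Finset.erase_subset _ _)))
    refine ⟨fun u => if u = v then U.filter (fun w => G.Adj v w) else out u, ?_, ?_⟩
    · intro u hu
      by_cases huv : u = v
      · simp only [huv, if_true]
        unfold dg at hvd
        omega
      · simp only [huv, if_false]
        exact ho.1 u (Finset.mem_erase.2 ⟨huv, hu⟩)
    · intro a ha b hb hadj
      by_cases hav : a = v
      · left
        subst hav
        simp [hb, hadj]
      · by_cases hbv : b = v
        · right
          subst hbv
          simp [ha, hadj.symm]
        · simp only [hav, hbv, if_false]
          exact ho.2 a (Finset.mem_erase.2 ⟨hav, ha⟩) b (Finset.mem_erase.2 ⟨hbv, hb⟩) hadj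

lemma exists_minimal_core {V : Type} (G : SimpleGraph V) (x : ℕ) (hx : 1 ≤ x) (S : Finset V)
    (hne : S.Nonempty) (hS : ∀ v ∈ S, x ≤ dg G v S) :
    ∃ T : Finset V, T.Nonempty ∧ (∀ v ∈ T, x ≤ dg G v T) ∧ ∃ out, Orients G T x out := by
  obtain ⟨T, hT, hmin⟩ := Finset.exists_min_image
    (S.powerset.filter (fun T => T.Nonempty ∧ ∀ v ∈ T, x ≤ dg G v T)) Finset.card
    ⟨S, by simp only [Finset.mem_filter, Finset.mem_powerset]; exact ⟨subset_rfl, hne, hS⟩⟩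
  simp only [Finset.mem_filter, Finset.mem_powerset] at hT hmin
  obtain ⟨hTS, ⟨v, hv⟩, hTd⟩ := hT
  refine ⟨T, ⟨v, hv⟩, hTd, ?_⟩
  obtain ⟨out, ho⟩ := degenerate_orients G x hx (T.erase v) (by
    intro U hU hUne
    by_contra hcon
    push Not at hcon
    have h1 := hmin U ⟨hU.trans ((Finset.erase_subset _ _).trans hTS), hUne, hcon⟩
    have h2 := Finset.card_le_card hU
    have h3 := Finset.card_erase_add_one hv
    omega)
  refine ⟨fun u => if u = v then ∅ else insert v (out u), ?_, ?_⟩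
  · intro u hu
    by_cases huv : u = v
    · simp [huv]
    · simp only [huv, if_false]
      have h1 := ho.1 u (Finset.mem_erase.2 ⟨huv, hu⟩)
      have h2 := Finset.card_insert_le v (out u)
      omega
  · intro a ha b hb hadj
    by_cases hav : a = v
    · right
      have hbv : b ≠ v := fun h => G.loopless.irrefl v (by rw [hav, h] at hadj; exact hadj)
      simp [hbv, hav]
    · by_cases hbv : b = v
      · left
        simp [hbv, hav]
      · simp only [hav, hbv, if_false, Finset.mem_insert]
        rcases ho.2 a (Finset.mem_erase.2 ⟨hav, ha⟩) b (Finset.mem_erase.2 ⟨hbv, hb⟩) hadj with h | h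
        · exact Or.inl (Or.inr h)
        · exact Or.inr (Or.inr h)

lemma dg_sdiff {V : Type} (G : SimpleGraph V) (v : V) {S T : Finset V} (h : S ⊆ T) :
    dg G v T = dg G v (T \ S) + dg G v S := by
  unfold dg
  rw [← Finset.card_union_of_disjoint
    (Finset.disjoint_filter_filter (Finset.sdiff_disjoint)), ← Finset.filter_union,
    Finset.sdiff_union_of_subset h]

lemma main_good (k r : ℕ) (hk : 1 ≤ k) : ∃ x : ℕ, ∀ (V : Type) [Fintype V] (G : SimpleGraph V),
    G.CliqueFree r → ∀ S : Finset V, S.Nonempty → (∀ v ∈ S, x ≤ dg G v S) → Good G k := by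
  obtain ⟨P, x0, hasym⟩ := asym_case k r hk
  set K := 8 * (P + 1) + 8 with hK
  set q := 1024 * K ^ 2 * k + 1 with hq
  obtain ⟨C, hC⟩ := large_indset q r
  refine ⟨x0 + q + C + 1, ?_⟩
  intro V _ G hG S hSne hSd
  set x := x0 + q + C + 1 with hx
  obtain ⟨T, hTne, hTd, out, hor⟩ := exists_minimal_core G x (by omega) S hSne hSd
  have hnpos : 1 ≤ T.card := Finset.card_pos.2 hTne
  set n := T.card with hn
  have hE := hor.sum_le
  let H := T.filter (fun v => K * x ≤ dg G v T)
  have hHT : H ⊆ T := Finset.filter_subset _ _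
  have hHc : K * H.card ≤ 2 * n := by
    have h1 : H.card * (K * x) ≤ ∑ v ∈ H, dg G v T := by
      rw [← smul_eq_mul]
      exact Finset.card_nsmul_le_sum _ _ _ (fun v hv => (Finset.mem_filter.1 hv).2)
    have h2 : ∑ v ∈ H, dg G v T ≤ ∑ v ∈ T, dg G v T := Finset.sum_le_sum_of_subset hHT
    have h3 : (K * H.card) * x ≤ (2 * n) * x := by
      calc (K * H.card) * x = H.card * (K * x) := by ring
        _ ≤ 2 * x * n := h1.trans (h2.trans hE)
        _ = _ := by ring
    exact Nat.le_of_mul_le_mul_right h3 (by omega)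
  let L := T \ H
  have hLT : L ⊆ T := Finset.sdiff_subset
  have hLc : L.card + H.card = n := Finset.card_sdiff_add_card_eq_card hHT
  let L1 := L.filter (fun v => x ≤ 2 * dg G v H)
  have hL1L : L1 ⊆ L := Finset.filter_subset _ _
  have hdLH : Disjoint L H := Finset.sdiff_disjoint
  by_cases hL1 : n ≤ 4 * L1.card
  · apply hasym V G hG x (by omega) L1 H out (Finset.disjoint_of_subset_left hL1L hdLH)
      (hor.mono (Finset.union_subset (hL1L.trans hLT) hHT))
      (fun a ha => (Finset.mem_filter.1 ha).2)
    have h1 : K * H.card = 8 * (P * H.card) + 16 * H.card := by rw [hK]; ring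
    rcases Nat.eq_zero_or_pos H.card with h0 | h0
    · rw [h0]; omega
    · omega
  · push Not at hL1
    have hH8 : 8 * H.card ≤ K * H.card := Nat.mul_le_mul_right _ (by omega)
    have hdegL : ∀ v ∈ L, dg G v L ≤ K * x := by
      intro v hv
      have hv' := Finset.mem_sdiff.1 hv
      have h1 : ¬ K * x ≤ dg G v T := fun h => hv'.2 (Finset.mem_filter.2 ⟨hv'.1, h⟩)
      have h2 := dg_mono G v hLT
      omega
    let L2 := L \ L1
    have hL2c : L2.card + L1.card = L.card := Finset.card_sdiff_add_card_eq_card hL1L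
    have hL2 : ∀ v ∈ L2, x ≤ 2 * dg G v L := by
      intro v hv
      have hv' := Finset.mem_sdiff.1 hv
      have h1 : ¬ x ≤ 2 * dg G v H := fun h => hv'.2 (Finset.mem_filter.2 ⟨hv'.1, h⟩)
      have h2 := dg_sdiff G v hHT
      have h3 := hTd v (hLT hv'.1)
      change dg G v T = dg G v L + dg G v H at h2
      omega
    have hEL : x * n ≤ 4 * ∑ v ∈ L, dg G v L := by
      have h1 : L2.card * x ≤ ∑ v ∈ L2, 2 * dg G v L := by
        rw [← smul_eq_mul]
        exact Finset.card_nsmul_le_sum _ _ _ hL2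
      have h2 : ∑ v ∈ L2, dg G v L ≤ ∑ v ∈ L, dg G v L :=
        Finset.sum_le_sum_of_subset Finset.sdiff_subset
      rw [← Finset.mul_sum] at h1
      have h3 : x * n ≤ x * (2 * L2.card) := Nat.mul_le_mul_left _ (by omega)
      have h4 : x * (2 * L2.card) = 2 * (L2.card * x) := by ring
      omega
    have hKx : x ≤ K * x := Nat.le_mul_of_pos_left _ (by omega)
    refine color_case G L x K q k n (by omega) (by omega) hnpos (by omega) (by omega)
      (by omega) hdegL ?_ hEL
    intro U hU
    obtain ⟨I, h1, h2, h3⟩ := hC V G hG U (K * x)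
      (fun v hv => (dg_mono G v hU).trans (hdegL v (hU hv)))
    refine ⟨I, h1, h2, h3.trans (Nat.mul_le_mul_right _ (by omega))⟩

lemma le_dg_univ {V : Type} [Fintype V] (G : SimpleGraph V) (v : V) :
    minDeg G ≤ dg G v Finset.univ := by
  unfold minDeg
  refine (G.minDegree_le_degree v).trans ?_
  rw [← SimpleGraph.card_neighborFinset_eq_degree]
  apply Finset.card_le_card
  intro u hu
  simpa using hu

lemma nonempty_of_minDeg {V : Type} [Fintype V] (G : SimpleGraph V) (h : 1 ≤ minDeg G) :
    Nonempty V := by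
  by_contra hcon
  rw [not_nonempty_iff] at hcon
  unfold minDeg at h
  rw [SimpleGraph.minDegree_of_subsingleton] at h
  omega

lemma clique_iso {V : Type} (G : SimpleGraph V) (d : ℕ) (Q : Finset V) (hQ : G.IsNClique d Q) :
    Nonempty (G.induce (Q : Set V) ≃g (⊤ : SimpleGraph (Fin d))) := by
  have e : (Q : Set V) ≃ Fin d := (Finset.equivFinOfCardEq hQ.card_eq)
  refine ⟨⟨e, ?_⟩⟩
  intro a b
  simp only [SimpleGraph.top_adj, SimpleGraph.comap_adj, Function.Embedding.subtype_apply,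
    SimpleGraph.induce]
  constructor
  · intro h
    exact hQ.isClique a.2 b.2 (fun h' => h (by rw [Subtype.ext h']))
  · intro h h'
    exact h.ne (by rw [e.injective h'])

/-- Kwan–Letzter–Sudakov–Tran: every graph of huge minimum degree has a nonempty induced
subgraph which is a complete graph `K_d`, or bipartite with minimum degree more than `d`. -/
theorem induced_clique_or_bipartite :
    ∃ f : ℕ → ℕ, ∀ d : ℕ, ∀ (V : Type) [Fintype V] (G : SimpleGraph V),
      f d ≤ minDeg G →
      ∃ s : Set V, s.Nonempty ∧
        (Nonempty (G.induce s ≃g (⊤ : SimpleGraph (Fin d))) ∨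
          (d < minDeg (G.induce s) ∧ Bip (G.induce s))) := by
  choose f hf using fun d : ℕ => main_good (d + 1) d (by omega)
  refine ⟨fun d => f d + 1, ?_⟩
  intro d V _ G hdeg
  replace hdeg : f d + 1 ≤ minDeg G := hdeg
  obtain ⟨v0⟩ := nonempty_of_minDeg G (by omega)
  rcases Nat.eq_zero_or_pos d with rfl | hd
  · have h1 : 0 < dg G v0 Finset.univ := lt_of_lt_of_le (by omega) (le_dg_univ G v0)
    obtain ⟨u, hu⟩ := Finset.card_pos.1 h1
    have hadj : G.Adj v0 u := (Finset.mem_filter.1 hu).2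
    obtain ⟨s, hs, h⟩ := finish G 1 {v0, u} {v0} {u} ⟨v0, by simp⟩ (by
      intro v hv
      apply Finset.card_pos.2
      rcases Finset.mem_insert.1 hv with h | h
      · exact ⟨u, by rw [h]; simp [hadj]⟩
      · rw [Finset.mem_singleton] at h
        exact ⟨v0, by rw [h]; simp [hadj.symm]⟩) (by intro z hz; simpa using hz)
      (by intro a ha b hb; simp only [Finset.mem_singleton] at ha hb; rw [ha, hb]; exact G.loopless.irrefl _)
      (by intro a ha b hb; simp only [Finset.mem_singleton] at ha hb; rw [ha, hb]; exact G.loopless.irrefl _)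
    exact ⟨s, hs, Or.inr h⟩
  by_cases hfree : G.CliqueFree d
  · obtain ⟨s, hs, h⟩ := (hf d V G hfree Finset.univ ⟨v0, by simp⟩ (fun v _ =>
      le_trans (by omega) (le_dg_univ G v))).finish
    exact ⟨s, hs, Or.inr h⟩
  · unfold SimpleGraph.CliqueFree at hfree
    push Not at hfree
    obtain ⟨Q, hQ⟩ := hfree
    refine ⟨(Q : Set V), ?_, Or.inl (clique_iso G d Q hQ)⟩
    have : Q.Nonempty := Finset.card_pos.1 (by rw [hQ.card_eq]; exact hd)
    simpa using this
end
end

section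
/- There is a function f : ℕ → ℕ such that for every natural number d, every finite bipartite graph G with minimum degree δ(G) ≥ f(d) has a nonempty induced subgraph H such that either H is isomorphic to the complete bipartite graph K_{d,d}, or δ(H) > d and H has no (not necessarily induced) subgraph isomorphic to the 4-cycle C₄. -/
open SimpleGraph
open scoped Classical
noncomputable section

/-- `G` contains `H` as a (not necessarily induced) subgraph. -/
def ContainsSub {V W : Type} (H : SimpleGraph V) (G : SimpleGraph W) : Prop :=
  ∃ f : V → W, Function.Injective f ∧ ∀ ⦃a b : V⦄, H.Adj a b → G.Adj (f a) (f b)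

/-- The 4-cycle. -/
def C4 : SimpleGraph (Fin 4) := SimpleGraph.fromRel fun i j => j = i + 1


/-- weight of `T` in the `p`-random subset of `B` -/
def rw' {β : Type} (p : ℝ) (B T : Finset β) : ℝ := p ^ T.card * (1 - p) ^ (B \ T).card

lemma rw_sum {β : Type} (p : ℝ) (B X S : Finset β) (hX : X ⊆ B) (hS : S ⊆ X) :
    ∑ T ∈ B.powerset, (if X ∩ T = S then rw' p B T else 0)
      = p ^ S.card * (1 - p) ^ (X \ S).card := by
  have key := Finset.prod_add (fun i => if i ∈ X \ S then (0:ℝ) else p)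
    (fun i => if i ∈ S then (0:ℝ) else 1 - p) B
  have h1 : ∏ i ∈ B, ((if i ∈ X \ S then (0:ℝ) else p) + (if i ∈ S then (0:ℝ) else 1 - p))
      = p ^ S.card * (1 - p) ^ (X \ S).card := by
    have : ∀ i ∈ B, ((if i ∈ X \ S then (0:ℝ) else p) + (if i ∈ S then (0:ℝ) else 1 - p))
        = (if i ∈ S then p else 1) * (if i ∈ X \ S then 1 - p else 1) := by
      intro i _
      by_cases h1 : i ∈ S <;> by_cases h2 : i ∈ X <;> simp [h1, h2]
    rw [Finset.prod_congr rfl this, Finset.prod_mul_distrib, Finset.prod_ite_mem,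
      Finset.prod_ite_mem, Finset.prod_const, Finset.prod_const,
      Finset.inter_eq_right.2 (hS.trans hX),
      Finset.inter_eq_right.2 (Finset.sdiff_subset.trans hX)]
  rw [← h1, key]
  refine Finset.sum_congr rfl fun T hT => ?_
  rw [Finset.mem_powerset] at hT
  split_ifs with h
  · rw [rw', ← Finset.prod_const, ← Finset.prod_const]
    congr 1
    · refine Finset.prod_congr rfl fun i hi => ?_
      rw [if_neg]
      grind
    · refine Finset.prod_congr rfl fun i hi => ?_
      rw [if_neg]
      grind
  · symm
    by_cases h2 : ∃ i ∈ T, i ∈ X \ S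
    · obtain ⟨i, hi, hi'⟩ := h2
      rw [Finset.prod_eq_zero hi (by simp only [hi', if_true]), zero_mul]
    · have : ∃ i ∈ B \ T, i ∈ S := by
        by_contra h3
        push Not at h2 h3
        apply h
        ext i
        have := h2 i
        have := h3 i
        have := @hX i
        have := @hS i
        grind
      obtain ⟨i, hi, hi'⟩ := this
      rw [Finset.prod_eq_zero hi (by simp only [hi', if_true]), mul_zero]

lemma rw_nonneg {β : Type} {p : ℝ} (h0 : 0 ≤ p) (h1 : p ≤ 1) (B T : Finset β) :
    0 ≤ rw' p B T := by
  have : 0 ≤ 1 - p := by linarith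
  unfold rw'; positivity

lemma rw_total {β : Type} (p : ℝ) (B : Finset β) : ∑ T ∈ B.powerset, rw' p B T = 1 := by
  have := rw_sum p B ∅ ∅ (by simp) (by simp)
  simpa using this

/-- averaging -/
lemma rw_avg {β : Type} {p : ℝ} (h0 : 0 ≤ p) (h1 : p ≤ 1) (B : Finset β) (g : Finset β → ℝ)
    (c : ℝ) (h : c ≤ ∑ T ∈ B.powerset, rw' p B T * g T) : ∃ T ⊆ B, c ≤ g T := by
  by_contra! hc
  have hs : ∑ T ∈ B.powerset, rw' p B T * g T < ∑ T ∈ B.powerset, rw' p B T * c := by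
    refine Finset.sum_lt_sum (fun T hT => mul_le_mul_of_nonneg_left
      (hc T (Finset.mem_powerset.1 hT)).le (rw_nonneg h0 h1 B T)) ?_
    by_contra! h2
    have : ∑ T ∈ B.powerset, rw' p B T ≤ 0 := by
      refine Finset.sum_nonpos fun T hT => ?_
      have := h2 T hT
      have := hc T (Finset.mem_powerset.1 hT)
      by_contra! h3
      nlinarith
    rw [rw_total] at this
    linarith
  rw [← Finset.sum_mul, rw_total] at hs
  linarith

/-- uniform sampling -/
lemma sample_half {α β : Type} (N S : α → Finset β) (A : Finset α) (B : Finset β) (K : ℕ)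
    (hK : ∀ a ∈ A, (N a ∩ B).card ≤ K) (hS : ∀ a ∈ A, S a ⊆ N a ∩ B) :
    ∃ T ⊆ B, A.card ≤ 2 ^ K * (A.filter (fun a => N a ∩ T = S a)).card := by
  obtain ⟨T, hT, h⟩ := rw_avg (p := 1/2) (by norm_num) (by norm_num) B
    (fun T => ((A.filter (fun a => N a ∩ T = S a)).card : ℝ)) ((1/2)^K * A.card) (by
      have : ∀ T ∈ B.powerset, rw' (1/2) B T * ((A.filter (fun a => N a ∩ T = S a)).card : ℝ)
          = ∑ a ∈ A, (if (N a ∩ B) ∩ T = S a then rw' (1/2) B T else 0) := by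
        intro T hT
        rw [Finset.mem_powerset] at hT
        rw [← Finset.sum_filter, Finset.sum_const, nsmul_eq_mul, mul_comm]
        simp only [Finset.inter_assoc, Finset.inter_eq_right.2 hT]
      rw [Finset.sum_congr rfl this, Finset.sum_comm, mul_comm, ← nsmul_eq_mul]
      refine Finset.card_nsmul_le_sum _ _ _ fun a ha => ?_
      rw [rw_sum _ _ _ _ Finset.inter_subset_right (hS a ha)]
      norm_num1
      rw [← pow_add]
      refine pow_le_pow_of_le_one (by norm_num) (by norm_num) ?_
      rw [add_comm, Finset.card_sdiff_add_card_eq_card (hS a ha)]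
      exact hK a ha)
  refine ⟨T, hT, ?_⟩
  have h2 : (0:ℝ) < 2 ^ K := by positivity
  rw [one_div, inv_pow, inv_mul_le_iff₀ h2] at h
  exact_mod_cast h

/-- greedy independent set -/
lemma greedy {α : Type} (A : Finset α) (r : α → α → Prop) (hr : ∀ x y, r x y → r y x) (m : ℕ)
    (hm : ∀ a ∈ A, (A.filter (fun a' => r a a')).card ≤ m) :
    ∃ I ⊆ A, (∀ a ∈ I, ∀ a' ∈ I, a ≠ a' → ¬ r a a') ∧ A.card ≤ (m + 1) * I.card := by
  have hne : (A.powerset.filter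
      (fun I => ∀ a ∈ I, ∀ a' ∈ I, a ≠ a' → ¬ r a a')).Nonempty := ⟨∅, by simp⟩
  obtain ⟨I, hI, hmax⟩ := Finset.exists_max_image _ Finset.card hne
  simp only [Finset.mem_filter, Finset.mem_powerset] at hI hmax
  refine ⟨I, hI.1, hI.2, ?_⟩
  have hsub : A ⊆ I.biUnion (fun a => insert a (A.filter (fun a' => r a a'))) := by
    intro x hx
    by_contra hc
    simp only [Finset.mem_biUnion, Finset.mem_insert, Finset.mem_filter] at hc
    push Not at hc
    have hxI : x ∉ I := fun h => (hc x h).1 rfl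
    have := hmax (insert x I) ⟨Finset.insert_subset hx hI.1, by
      intro a ha a' ha' hne
      rw [Finset.mem_insert] at ha ha'
      rcases ha with rfl | ha <;> rcases ha' with rfl | ha'
      · exact absurd rfl hne
      · exact fun h => (hc a' ha').2 hx (hr _ _ h)
      · exact fun h => (hc a ha).2 hx h
      · exact hI.2 a ha a' ha' hne⟩
    rw [Finset.card_insert_of_notMem hxI] at this
    omega
  calc A.card ≤ _ := Finset.card_le_card hsub
    _ ≤ ∑ a ∈ I, (insert a (A.filter (fun a' => r a a'))).card := Finset.card_biUnion_le
    _ ≤ ∑ a ∈ I, (m + 1) := Finset.sum_le_sum fun a ha =>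
        (Finset.card_insert_le _ _).trans (by have := hm a (hI.1 ha); omega)
    _ = _ := by rw [Finset.sum_const, smul_eq_mul, mul_comm]

lemma unbal (D t s : ℕ) : ∃ K M : ℕ, ∀ (α β : Type) (N : α → Finset β) (A : Finset α)
    (B : Finset β), A.Nonempty → (∀ a ∈ A, (N a ∩ B).card = K) → M * B.card ≤ A.card →
    (∀ S ⊆ B, S.card = s → (A.filter (fun a => S ⊆ N a)).card < t) →
    ∃ A' ⊆ A, ∃ B' ⊆ B, A'.Nonempty ∧ (∀ a ∈ A', (N a ∩ B').card = D) ∧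
      (∀ a ∈ A', ∀ a' ∈ A', a ≠ a' → (N a ∩ N a' ∩ B').card ≤ 1) ∧ B'.card ≤ A'.card := by
  induction s with
  | zero =>
    refine ⟨1, t, fun α β N A B hA hN hM hf => ?_⟩
    exfalso
    obtain ⟨a, ha⟩ := hA
    have h1 := hN a ha
    have h2 : 1 ≤ B.card := h1 ▸ Finset.card_le_card Finset.inter_subset_right
    have h3 := hf ∅ (by simp) (by simp)
    simp at h3
    nlinarith
  | succ s ih =>
    obtain ⟨K₀, M₀, ih⟩ := ih
    obtain ⟨K, hKdef⟩ : ∃ K, K = D * (K₀ + 1) := ⟨_, rfl⟩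
    obtain ⟨θ, hθ⟩ : ∃ θ, θ = 2 ^ K * (2 * K * K) * M₀ := ⟨_, rfl⟩
    obtain ⟨M, hM'⟩ : ∃ M, M = 2 * (2 ^ K * (D * D * θ + 1)) := ⟨_, rfl⟩
    refine ⟨K, M, fun α β N A B hA hN hM hf => ?_⟩
    set codeg : β → β → ℕ := fun b b' => (A.filter (fun a => b ∈ N a ∧ b' ∈ N a)).card with hcd
    set heavy : β → β → Prop := fun b b' => b ≠ b' ∧ θ ≤ codeg b b' with hhv
    have hsymm : ∀ x y, heavy x y → heavy y x := by
      rintro x y ⟨h1, h2⟩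
      refine ⟨h1.symm, h2.trans (le_of_eq ?_)⟩
      simp only [hcd]
      congr 1
      ext a
      simp [and_comm]
    set P : α → Prop := fun a => ∃ I ⊆ N a ∩ B, I.card = D ∧
      ∀ b ∈ I, ∀ b' ∈ I, b ≠ b' → ¬ heavy b b' with hP
    have hsplit := Finset.card_filter_add_card_filter_not (s := A) P
    by_cases hcase : A.card ≤ 2 * (A.filter P).card
    · have : ∀ a, ∃ I, P a → I ⊆ N a ∩ B ∧ I.card = D ∧
          ∀ b ∈ I, ∀ b' ∈ I, b ≠ b' → ¬ heavy b b' := by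
        intro a
        by_cases h : P a
        · obtain ⟨I, h1, h2⟩ := h
          exact ⟨I, fun _ => ⟨h1, h2⟩⟩
        · exact ⟨∅, fun h' => absurd h' h⟩
      choose I hI using this
      obtain ⟨T, hT, hTc⟩ := sample_half N I (A.filter P) B K
        (fun a ha => (hN a (Finset.mem_filter.1 ha).1).le)
        (fun a ha => (hI a (Finset.mem_filter.1 ha).2).1)
      set A1 := (A.filter P).filter (fun a => N a ∩ T = I a) with hA1
      have hA1m : ∀ a ∈ A1, a ∈ A ∧ P a ∧ N a ∩ T = I a := by
        intro a ha
        simp only [hA1, Finset.mem_filter] at ha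
        exact ⟨ha.1.1, ha.1.2, ha.2⟩
      obtain ⟨X, hX, hXi, hXc⟩ := greedy A1
        (fun a a' => a ≠ a' ∧ 2 ≤ (N a ∩ N a' ∩ T).card)
        (fun x y h => ⟨h.1.symm, by rw [Finset.inter_comm (N y)]; exact h.2⟩) (D * D * θ) (by
          intro a ha
          obtain ⟨haA, haP, haI⟩ := hA1m a ha
          obtain ⟨hI1, hI2, hI3⟩ := hI a haP
          have hsub : A1.filter (fun a' => a ≠ a' ∧ 2 ≤ (N a ∩ N a' ∩ T).card) ⊆
              (I a).offDiag.biUnion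
                (fun q => A.filter (fun a' => q.1 ∈ N a' ∧ q.2 ∈ N a')) := by
            intro a' ha'
            rw [Finset.mem_filter] at ha'
            obtain ⟨h1, -, h3⟩ := ha'
            obtain ⟨x, hx, y, hy, hxy⟩ := Finset.one_lt_card.1 h3
            rw [Finset.mem_biUnion]
            simp only [Finset.mem_inter] at hx hy
            refine ⟨(x, y), ?_, ?_⟩
            · rw [Finset.mem_offDiag, ← haI]
              simp only [Finset.mem_inter]
              tauto
            · rw [Finset.mem_filter]
              exact ⟨(hA1m a' h1).1, hx.1.2, hy.1.2⟩
          have hgoal := Finset.card_le_card hsub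
          refine le_trans (le_of_eq (by congr)) (hgoal.trans ?_)
          refine (Finset.card_biUnion_le_card_mul _ _ θ ?_).trans ?_
          · intro q hq
            rw [Finset.mem_offDiag] at hq
            have := hI3 q.1 hq.1 q.2 hq.2.1 hq.2.2
            simp only [hhv, not_and, not_le] at this
            exact (this hq.2.2).le
          · refine Nat.mul_le_mul_right _ ?_
            rw [Finset.offDiag_card, hI2]
            omega)
      have hfin : A.card ≤ M * X.card := by
        calc A.card ≤ 2 * (A.filter P).card := hcase
          _ ≤ 2 * (2 ^ K * A1.card) := by gcongr
          _ ≤ 2 * (2 ^ K * ((D * D * θ + 1) * X.card)) := by gcongr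
          _ = M * X.card := by rw [hM']; ring
      have hMpos : 0 < M := by rw [hM']; positivity
      refine ⟨X, fun a ha => (hA1m a (hX ha)).1, T, hT, ?_, ?_, ?_, ?_⟩
      · rw [← Finset.card_pos]
        have := hA.card_pos
        exact Nat.pos_of_mul_pos_left (lt_of_lt_of_le this hfin)
      · intro a ha
        obtain ⟨_, h2, h3⟩ := hA1m a (hX ha)
        rw [h3]
        exact (hI a h2).2.1
      · intro a ha a' ha' hne
        have := hXi a ha a' ha' hne
        simp only [not_and, not_le] at this
        have := this hne
        omega
      · refine Nat.le_of_mul_le_mul_left ?_ hMpos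
        exact (Nat.mul_le_mul_left M (Finset.card_le_card hT)).trans (hM.trans hfin)
    · set A2 := A.filter (fun a => ¬ P a) with hA2
      have hA2c : A.card < 2 * A2.card := by omega
      have hstar : ∀ a ∈ A2, ∃ b ∈ N a ∩ B, K₀ ≤ ((N a ∩ B).filter (heavy b)).card := by
        intro a ha
        rw [hA2, Finset.mem_filter] at ha
        by_contra! hc
        obtain ⟨I, hI1, hI2, hI3⟩ := greedy (N a ∩ B) heavy hsymm K₀ 
          (fun b hb => le_trans (le_of_eq (by congr)) (hc b hb).le)
        rw [hN a ha.1, hKdef, mul_comm] at hI3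
        obtain ⟨J, hJ, hJc⟩ := Finset.exists_subset_card_eq
          (Nat.le_of_mul_le_mul_left hI3 (Nat.succ_pos _))
        exact ha.2 ⟨J, hJ.trans hI1, hJc, fun b hb b' hb' => hI2 b (hJ hb) b' (hJ hb')⟩
      have hA2n : A2.Nonempty := by
        rw [← Finset.card_pos]; omega
      obtain ⟨a₀, ha₀⟩ := hA2n
      obtain ⟨b₀, hb₀, -⟩ := hstar a₀ ha₀
      have hKpos : 0 < K := by
        rw [← hN a₀ (Finset.mem_filter.1 ha₀).1]
        exact Finset.card_pos.2 ⟨b₀, hb₀⟩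
      have : Nonempty β := ⟨b₀⟩
      choose! c hc1 hc2 using hstar
      have hb : ∃ b ∈ B, (A2.filter (fun a => c a = b)).Nonempty ∧
          (A.filter (fun a => b ∈ N a)).card ≤ 2 * K * (A2.filter (fun a => c a = b)).card := by
        by_contra! hcon
        have h1 : ∑ b ∈ B, 2 * K * (A2.filter (fun a => c a = b)).card
            < ∑ b ∈ B, (A.filter (fun a => b ∈ N a)).card := by
          refine Finset.sum_lt_sum ?_ ?_
          · intro b hb
            rcases Finset.eq_empty_or_nonempty (A2.filter (fun a => c a = b)) with h | h
            · rw [h]; simp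
            · exact (hcon b hb h).le
          · have := hc1 a₀ ha₀
            exact ⟨c a₀, (Finset.mem_inter.1 this).2, hcon _ (Finset.mem_inter.1 this).2
              ⟨a₀, by simp [ha₀]⟩⟩
        rw [← Finset.mul_sum, ← Finset.card_eq_sum_card_fiberwise
          (fun a ha => (Finset.mem_inter.1 (hc1 a ha)).2)] at h1
        have h2 : ∑ b ∈ B, (A.filter (fun a => b ∈ N a)).card = A.card * K := by
          have := Finset.sum_card_bipartiteAbove_eq_sum_card_bipartiteBelow
            (s := A) (t := B) (fun a b => b ∈ N a)
          simp only [Finset.bipartiteAbove, Finset.bipartiteBelow] at this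
          rw [← this, Finset.sum_congr rfl (g := fun _ => K)]
          · simp
          · intro a ha
            rw [← hN a ha, Finset.inter_comm, Finset.filter_mem_eq_inter]
        rw [h2] at h1
        nlinarith
      obtain ⟨b, hbB, hbn, hbc⟩ := hb
      set Ab := A2.filter (fun a => c a = b) with hAb
      set Bb := B.filter (heavy b) with hBb
      have hAbm : ∀ a ∈ Ab, a ∈ A ∧ b ∈ N a ∧ K₀ ≤ (N a ∩ Bb).card := by
        intro a ha
        rw [hAb, Finset.mem_filter] at ha
        obtain ⟨h1, rfl⟩ := ha
        refine ⟨(Finset.mem_filter.1 h1).1, (Finset.mem_inter.1 (hc1 a h1)).1, ?_⟩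
        refine (hc2 a h1).trans (Finset.card_le_card fun x hx => ?_)
        rw [Finset.mem_filter, Finset.mem_inter] at hx
        rw [hBb, Finset.mem_inter, Finset.mem_filter]
        exact ⟨hx.1.1, hx.1.2, hx.2⟩
      have hcount : θ * Bb.card ≤ 2 * K * K * Ab.card := by
        have h1 : Bb.card * θ ≤ ∑ b' ∈ Bb,
            ((A.filter (fun a => b ∈ N a)).filter (fun a => b' ∈ N a)).card := by
          rw [← smul_eq_mul]
          refine Finset.card_nsmul_le_sum _ _ _ fun b' hb' => ?_
          rw [Finset.filter_filter]
          exact (Finset.mem_filter.1 hb').2.2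
        have h2 := Finset.sum_card_bipartiteAbove_eq_sum_card_bipartiteBelow
            (s := A.filter (fun a => b ∈ N a)) (t := Bb) (fun a b => b ∈ N a)
        simp only [Finset.bipartiteAbove, Finset.bipartiteBelow] at h2
        rw [← h2] at h1
        have h3 : ∑ a ∈ A.filter (fun a => b ∈ N a), (Bb.filter (fun b' => b' ∈ N a)).card
            ≤ (A.filter (fun a => b ∈ N a)).card * K := by
          rw [← smul_eq_mul]
          refine Finset.sum_le_card_nsmul _ _ _ fun a ha => ?_
          rw [← hN a (Finset.mem_filter.1 ha).1]
          refine Finset.card_le_card fun x hx => ?_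
          simp only [hBb, Finset.mem_filter] at hx
          exact Finset.mem_inter.2 ⟨hx.2, hx.1.1⟩
        nlinarith
      have : ∀ a, ∃ S, a ∈ Ab → S ⊆ N a ∩ Bb ∧ S.card = K₀ := by
        intro a
        by_cases h : a ∈ Ab
        · obtain ⟨S, h1⟩ := Finset.exists_subset_card_eq (hAbm a h).2.2
          exact ⟨S, fun _ => h1⟩
        · exact ⟨∅, fun h' => absurd h' h⟩
      choose S hS using this
      have hBbB : Bb ⊆ B := Finset.filter_subset _ _
      obtain ⟨T, hT, hTc⟩ := sample_half N S Ab Bb K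
        (fun a ha => by
          rw [← hN a (hAbm a ha).1]
          exact Finset.card_le_card (Finset.inter_subset_inter_left hBbB))
        (fun a ha => (hS a ha).1)
      set As := Ab.filter (fun a => N a ∩ T = S a) with hAs
      have hAsA : As ⊆ A := fun a ha => (hAbm a (Finset.mem_filter.1 ha).1).1
      obtain ⟨A', hA', B', hB', hrest⟩ := ih α β N As T
        (by
          rw [← Finset.card_pos]
          exact Nat.pos_of_mul_pos_left (lt_of_lt_of_le hbn.card_pos hTc))
        (by
          intro a ha
          have := Finset.mem_filter.1 ha
          rw [this.2]
          exact (hS a this.1).2)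
        (by
          refine Nat.le_of_mul_le_mul_left (c := 2 ^ K * (2 * K * K)) ?_ (by positivity)
          calc 2 ^ K * (2 * K * K) * (M₀ * T.card) = θ * T.card := by rw [hθ]; ring
            _ ≤ θ * Bb.card := Nat.mul_le_mul_left _ (Finset.card_le_card hT)
            _ ≤ 2 * K * K * Ab.card := hcount
            _ ≤ 2 * K * K * (2 ^ K * As.card) := Nat.mul_le_mul_left _ hTc
            _ = _ := by ring)
        (by
          intro Q hQ hQc
          have hbQ : b ∉ Q := by
            intro h
            have := hT (hQ h)
            rw [hBb, Finset.mem_filter] at this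
            exact this.2.1 rfl
          have := hf (insert b Q)
            (Finset.insert_subset hbB ((hQ.trans hT).trans hBbB))
            (by rw [Finset.card_insert_of_notMem hbQ, hQc])
          refine lt_of_le_of_lt (Finset.card_le_card ?_) this
          intro a ha
          rw [Finset.mem_filter] at ha ⊢
          exact ⟨hAsA ha.1, Finset.insert_subset (hAbm a (Finset.mem_filter.1 ha.1).1).2.1 ha.2⟩)
      exact ⟨A', hA'.trans hAsA, B', (hB'.trans hT).trans hBbB, hrest⟩

lemma prob_bound {β : Type} (K : ℕ) (ρ : ℝ) (B X : Finset β) (hX : X ⊆ B) (h2 : 2 ≤ ρ)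
    (hK : 2 * (K : ℝ) ≤ ρ) (h1 : ρ ≤ X.card) (h8 : (X.card : ℝ) ≤ 8 * ρ) :
    Real.exp (-16) / (2 ^ K * (K.factorial : ℝ)) ≤
      ∑ T ∈ B.powerset, (if (X ∩ T).card = K then rw' (1 / ρ) B T else 0) := by
  have hρ : 0 < ρ := by linarith
  have hp1 : 1 / ρ ≤ 1 := by rw [div_le_one hρ]; linarith
  have e1 : ∑ T ∈ B.powerset, (if (X ∩ T).card = K then rw' (1 / ρ) B T else 0)
      = (X.card.choose K : ℝ) * ((1 / ρ) ^ K * (1 - 1 / ρ) ^ (X.card - K)) := by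
    have : ∀ T ∈ B.powerset, (if (X ∩ T).card = K then rw' (1 / ρ) B T else 0)
        = ∑ S ∈ X.powersetCard K, (if X ∩ T = S then rw' (1 / ρ) B T else 0) := by
      intro T _
      rw [Finset.sum_ite_eq]
      simp [Finset.mem_powersetCard]
    rw [Finset.sum_congr rfl this, Finset.sum_comm, ← Finset.card_powersetCard, ← nsmul_eq_mul,
      ← Finset.sum_const]
    refine Finset.sum_congr rfl fun S hS => ?_
    rw [Finset.mem_powersetCard] at hS
    rw [rw_sum _ _ _ _ hX hS.1, Finset.card_sdiff_of_subset hS.1, hS.2]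
  rw [e1]
  have hx : 0 < ρ - 1 := by linarith
  have a1 : Real.exp (-(1 / (ρ - 1))) ≤ 1 - 1 / ρ := by
    rw [Real.exp_neg]
    have := Real.add_one_le_exp (1 / (ρ - 1))
    have h3 : (1 - 1 / ρ) = (1 / (ρ - 1) + 1)⁻¹ := by
      field_simp
      ring
    rw [h3]
    exact inv_anti₀ (by positivity) this
  have a2 : Real.exp (-16) ≤ (1 - 1 / ρ) ^ (X.card - K) := by
    calc Real.exp (-16) ≤ Real.exp (-(1 / (ρ - 1))) ^ X.card := by
          rw [← Real.exp_nat_mul, Real.exp_le_exp, mul_neg, neg_le_neg_iff, mul_one_div,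
            div_le_iff₀ hx]
          linarith
      _ ≤ (1 - 1 / ρ) ^ X.card := pow_le_pow_left₀ (Real.exp_pos _).le a1 _
      _ ≤ _ := pow_le_pow_of_le_one (by linarith)
          (by have : 0 < 1 / ρ := by positivity
              linarith) (Nat.sub_le _ _)
  have a3 : 1 / (2 ^ K * (K.factorial : ℝ)) ≤ (X.card.choose K : ℝ) * (1 / ρ) ^ K := by
    have hc := Nat.pow_le_choose (α := ℝ) K X.card
    have hKX : K ≤ X.card := by
      have : (K : ℝ) ≤ X.card := by
        have : (0:ℝ) ≤ K := by positivity
        linarith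
      exact_mod_cast this
    have h4 : ρ / 2 ≤ ((X.card + 1 - K : ℕ) : ℝ) := by
      rw [Nat.cast_sub (by omega)]
      push_cast
      linarith
    have h5 : (ρ / 2) ^ K ≤ ((X.card + 1 - K : ℕ) : ℝ) ^ K :=
      pow_le_pow_left₀ (by positivity) h4 _
    have hf : (0:ℝ) < K.factorial := by positivity
    calc 1 / (2 ^ K * (K.factorial : ℝ)) = (ρ / 2) ^ K / K.factorial * (1 / ρ) ^ K := by
          rw [div_pow, div_pow]
          field_simp
          simp
      _ ≤ ((X.card + 1 - K : ℕ) : ℝ) ^ K / K.factorial * (1 / ρ) ^ K := by gcongr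
      _ ≤ _ := by gcongr
  calc Real.exp (-16) / (2 ^ K * (K.factorial : ℝ))
      = 1 / (2 ^ K * (K.factorial : ℝ)) * Real.exp (-16) := by ring
    _ ≤ ((X.card.choose K : ℝ) * (1 / ρ) ^ K) * (1 - 1 / ρ) ^ (X.card - K) := by gcongr
    _ = _ := by ring

lemma sample_main (K M : ℕ) : ∃ R : ℝ, ∀ (α β : Type) (N : α → Finset β) (A : Finset α)
    (B : Finset β) (ρ : ℝ), R ≤ ρ → A.Nonempty → (∀ a ∈ A, ρ ≤ (N a ∩ B).card) →
    (∑ a ∈ A, ((N a ∩ B).card : ℝ)) ≤ 4 * ρ * A.card → B.card ≤ A.card →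
    ∃ T ⊆ B, ∃ A' ⊆ A, A'.Nonempty ∧ (∀ a ∈ A', (N a ∩ T).card = K) ∧
      M * T.card ≤ A'.card := by
  obtain ⟨c, hc⟩ : ∃ c, c = Real.exp (-16) / (2 ^ K * (K.factorial : ℝ)) := ⟨_, rfl⟩
  have hc0 : 0 < c := by rw [hc]; positivity
  refine ⟨2 * M / c + 2 * K + 3, fun α β N A B ρ hR hA hlo hsum hBA => ?_⟩
  have hMc : 0 ≤ 2 * M / c := by positivity
  have hK0 : (0:ℝ) ≤ K := by positivity
  have hρ2 : 2 ≤ ρ := by linarith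
  have hρ : 0 < ρ := by linarith
  have hA0 : (0:ℝ) < A.card := by exact_mod_cast hA.card_pos
  set A1 := A.filter (fun a => ((N a ∩ B).card : ℝ) ≤ 8 * ρ) with hA1
  have hhalf : (A.card : ℝ) ≤ 2 * A1.card := by
    have h1 := Finset.card_filter_add_card_filter_not (s := A)
      (fun a => ((N a ∩ B).card : ℝ) ≤ 8 * ρ)
    have h1' : (A1.card : ℝ) + (A.filter (fun a => ¬ ((N a ∩ B).card : ℝ) ≤ 8 * ρ)).card
        = A.card := by exact_mod_cast h1
    have h2 : (A.filter (fun a => ¬ ((N a ∩ B).card : ℝ) ≤ 8 * ρ)).card • (8 * ρ) ≤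
        ∑ a ∈ A.filter (fun a => ¬ ((N a ∩ B).card : ℝ) ≤ 8 * ρ), ((N a ∩ B).card : ℝ) :=
      Finset.card_nsmul_le_sum _ _ _ fun a ha => by
        rw [Finset.mem_filter] at ha
        linarith [ha.2]
    have h3 := h2.trans (Finset.sum_le_sum_of_subset_of_nonneg
      (Finset.filter_subset _ A) (fun a _ _ => by positivity))
    rw [nsmul_eq_mul] at h3
    have h4 := h3.trans hsum
    have : ((A.filter (fun a => ¬ ((N a ∩ B).card : ℝ) ≤ 8 * ρ)).card : ℝ) * 2 ≤ A.card := by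
      by_contra hcon
      rw [not_le] at hcon
      nlinarith
    linarith
  have hp1 : 1 / ρ ≤ 1 := by rw [div_le_one hρ]; linarith
  have hpos : 0 < A.card * (c / 2 - M / ρ) := by
    apply mul_pos hA0
    have : 2 * M / c < ρ := by linarith
    rw [div_lt_iff₀ hc0] at this
    rw [sub_pos, div_lt_div_iff₀ hρ (by norm_num)]
    linarith
  obtain ⟨T, hT, hg⟩ := rw_avg (p := 1 / ρ) (by positivity) hp1 B
    (fun T => ((A1.filter (fun a => (N a ∩ T).card = K)).card : ℝ) - M * T.card)
    (A.card * (c / 2 - M / ρ)) (by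
      have e1 : ∀ T ∈ B.powerset, rw' (1 / ρ) B T *
          (((A1.filter (fun a => (N a ∩ T).card = K)).card : ℝ) - M * T.card)
          = (∑ a ∈ A1, (if ((N a ∩ B) ∩ T).card = K then rw' (1 / ρ) B T else 0))
            - M * ∑ b ∈ B, (if {b} ∩ T = {b} then rw' (1 / ρ) B T else 0) := by
        intro T hT
        rw [Finset.mem_powerset] at hT
        have : ∀ b, {b} ∩ T = {b} ↔ b ∈ T := by
          intro b
          rw [Finset.inter_eq_left, Finset.singleton_subset_iff]
        simp only [this]
        rw [← Finset.sum_filter, ← Finset.sum_filter, Finset.sum_const, Finset.sum_const,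
          nsmul_eq_mul, nsmul_eq_mul, Finset.filter_mem_eq_inter, Finset.inter_eq_right.2 hT]
        simp only [Finset.inter_assoc, Finset.inter_eq_right.2 hT]
        ring
      rw [Finset.sum_congr rfl e1, Finset.sum_sub_distrib, ← Finset.mul_sum, Finset.sum_comm,
        Finset.sum_comm (s := B.powerset) (t := B)]
      have e2 : A1.card • c ≤ ∑ a ∈ A1, ∑ T ∈ B.powerset,
          (if ((N a ∩ B) ∩ T).card = K then rw' (1 / ρ) B T else 0) := by
        refine Finset.card_nsmul_le_sum _ _ _ fun a ha => ?_
        rw [hA1, Finset.mem_filter] at ha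
        rw [hc]
        exact prob_bound K ρ B _ Finset.inter_subset_right hρ2 (by linarith) (hlo a ha.1) ha.2
      have e3 : ∑ b ∈ B, ∑ T ∈ B.powerset, (if {b} ∩ T = {b} then rw' (1 / ρ) B T else 0)
          = B.card * (1 / ρ) := by
        rw [← nsmul_eq_mul, ← Finset.sum_const]
        refine Finset.sum_congr rfl fun b hb => ?_
        rw [rw_sum _ _ _ _ (Finset.singleton_subset_iff.2 hb) (Finset.Subset.refl _)]
        simp
      rw [e3]
      rw [nsmul_eq_mul] at e2
      have hBA' : (B.card : ℝ) ≤ A.card := by exact_mod_cast hBA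
      have e4 : (M : ℝ) * (B.card * (1 / ρ)) ≤ M * (A.card * (1 / ρ)) := by gcongr
      have e5 : A.card * (c / 2) ≤ A1.card * c := by nlinarith
      have e6 : A.card * (c / 2 - M / ρ) = A.card * (c / 2) - M * (A.card * (1 / ρ)) := by ring
      linarith)
  have hg' := lt_of_lt_of_le hpos hg
  refine ⟨T, hT, A1.filter (fun a => (N a ∩ T).card = K),
    (Finset.filter_subset _ _).trans (Finset.filter_subset _ _), ?_, ?_, ?_⟩
  · rw [← Finset.card_pos]
    have : (0:ℝ) < (A1.filter (fun a => (N a ∩ T).card = K)).card := by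
      have : (0:ℝ) ≤ M * T.card := by positivity
      linarith
    exact_mod_cast this
  · intro a ha
    exact (Finset.mem_filter.1 ha).2
  · have : (M * T.card : ℝ) ≤ (A1.filter (fun a => (N a ∩ T).card = K)).card := by linarith
    exact_mod_cast this

lemma max_ratio {V : Type} (G : SimpleGraph V) (W₀ : Finset V) (hW : W₀.Nonempty) (l₀ : ℝ)
    (h : l₀ * W₀.card ≤ ∑ v ∈ W₀, ((W₀.filter (fun u => G.Adj v u)).card : ℝ)) :
    ∃ W ⊆ W₀, W.Nonempty ∧ ∃ l : ℝ, l₀ ≤ l ∧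
      ∑ v ∈ W, ((W.filter (fun u => G.Adj v u)).card : ℝ) = l * W.card ∧
      ∀ v ∈ W, l ≤ 2 * (W.filter (fun u => G.Adj v u)).card := by
  set E : Finset V → ℝ := fun W => ∑ v ∈ W, ((W.filter (fun u => G.Adj v u)).card : ℝ) with hE
  obtain ⟨W, hWm, hmax⟩ := Finset.exists_max_image (W₀.powerset.filter Finset.Nonempty)
    (fun W => E W / W.card) ⟨W₀, by simp [hW]⟩
  simp only [Finset.mem_filter, Finset.mem_powerset] at hWm hmax
  have hpos : ∀ X : Finset V, X.Nonempty → (0:ℝ) < X.card := fun X hX => by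
    exact_mod_cast hX.card_pos
  have hWp := hpos W hWm.2
  refine ⟨W, hWm.1, hWm.2, E W / W.card, ?_, ?_, ?_⟩
  · refine le_trans ?_ (hmax W₀ ⟨Finset.Subset.refl _, hW⟩)
    rw [le_div_iff₀ (hpos _ hW)]
    exact h
  · change E W = _
    field_simp
  · intro v hv
    have h1 : E W ≤ E (W.erase v) + 2 * (W.filter (fun u => G.Adj v u)).card := by
      have e1 : E W = ((W.filter (fun u => G.Adj v u)).card : ℝ)
          + ∑ u ∈ W.erase v, ((W.filter (fun x => G.Adj u x)).card : ℝ) := by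
        rw [hE]
        exact (Finset.add_sum_erase W _ hv).symm
      have e2 : ∑ u ∈ W.erase v, ((W.filter (fun x => G.Adj u x)).card : ℝ) ≤
          ∑ u ∈ W.erase v, ((((W.erase v).filter (fun x => G.Adj u x)).card : ℝ)
            + if G.Adj v u then 1 else 0) := by
        refine Finset.sum_le_sum fun u _ => ?_
        rw [Finset.filter_erase]
        split_ifs with hadj
        · rw [Finset.card_erase_of_mem (by simp [hv, hadj.symm])]
          have : 0 < (W.filter (fun x => G.Adj u x)).card :=
            Finset.card_pos.2 ⟨v, by simp [hv, hadj.symm]⟩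
          rw [Nat.cast_sub this]
          simp
        · rw [Finset.erase_eq_of_notMem]
          · simp
          · simp only [Finset.mem_filter, not_and]
            exact fun _ h => hadj h.symm
      rw [Finset.sum_add_distrib] at e2
      have e3 : ∑ u ∈ W.erase v, (if G.Adj v u then (1:ℝ) else 0)
          ≤ (W.filter (fun u => G.Adj v u)).card := by
        rw [← Finset.sum_filter, Finset.sum_const, nsmul_eq_mul, mul_one]
        exact_mod_cast Finset.card_le_card (Finset.filter_subset_filter _ (Finset.erase_subset _ _))
      have e4 : E (W.erase v)
          = ∑ u ∈ W.erase v, (((W.erase v).filter (fun x => G.Adj u x)).card : ℝ) := rfl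
      linarith
    have h2 : E (W.erase v) ≤ E W / W.card * (W.erase v).card := by
      rcases Finset.eq_empty_or_nonempty (W.erase v) with h | h
      · rw [h]; simp [hE]
      · have := hmax _ ⟨(Finset.erase_subset v W).trans hWm.1, h⟩
        rwa [div_le_iff₀ (hpos _ h)] at this
    have h3 : ((W.erase v).card : ℝ) = W.card - 1 := by
      rw [Finset.card_erase_of_mem hv, Nat.cast_sub hWm.2.card_pos]
      simp
    have h4 : E W / W.card * W.card = E W := by field_simp
    rw [h3] at h2
    linarith

lemma minDeg_induce {V : Type} [Fintype V] (G : SimpleGraph V) (W : Finset V) (hW : W.Nonempty)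
    (k : ℕ) (h : ∀ v ∈ W, k ≤ (W.filter (fun u => G.Adj v u)).card) (s : Set V)
    (hs : ∀ v, v ∈ s ↔ v ∈ W) :
    k ≤ minDeg (G.induce s) := by
  unfold minDeg
  have : Nonempty s := ⟨⟨_, (hs _).2 hW.choose_spec⟩⟩
  refine SimpleGraph.le_minDegree_of_forall_le_degree _ _ fun v => ?_
  refine (h v.1 ((hs _).1 v.2)).trans ?_
  rw [← SimpleGraph.card_neighborFinset_eq_degree]
  refine Finset.card_le_card_of_surjOn (fun x => x.1) ?_
  intro u hu
  simp only [Finset.coe_filter, Set.mem_ofPred_eq] at hu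
  exact ⟨⟨u, (hs _).2 hu.1⟩, by simpa using hu.2, rfl⟩

/-- a complete pair of `d`-sets on the two sides gives an induced biclique -/
lemma biclique {V : Type} [Fintype V] (G : SimpleGraph V) (X : Set V)
    (hX : ∀ ⦃a b : V⦄, G.Adj a b → (a ∈ X ↔ b ∉ X)) (d : ℕ) (hd : 0 < d) (S R : Finset V)
    (hS : ∀ v ∈ S, v ∉ X) (hR : ∀ v ∈ R, v ∈ X) (hSc : S.card = d) (hRc : R.card = d)
    (hadj : ∀ r ∈ R, ∀ v ∈ S, G.Adj r v) :
    ∃ s : Set V, s.Nonempty ∧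
      Nonempty (G.induce s ≃g completeBipartiteGraph (Fin d) (Fin d)) := by
  let e1 := (S.equivFinOfCardEq hSc).symm
  let e2 := (R.equivFinOfCardEq hRc).symm
  let φ : completeBipartiteGraph (Fin d) (Fin d) ↪g G :=
    { toFun := Sum.elim (fun i => (e1 i).1) (fun i => (e2 i).1)
      inj' := by
        rintro (i | i) (j | j) h
        · simpa [Subtype.ext_iff] using e1.injective (Subtype.ext h)
        · exact absurd (hR _ (e2 j).2) (by rw [← show (e1 i).1 = (e2 j).1 from h]; exact hS _ (e1 i).2)
        · exact absurd (hR _ (e2 i).2) (by rw [show (e2 i).1 = (e1 j).1 from h]; exact hS _ (e1 j).2)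
        · simpa [Subtype.ext_iff] using e2.injective (Subtype.ext h)
      map_rel_iff' := by
        rintro (i | i) (j | j)
        · have := hS _ (e1 i).2
          have := hS _ (e1 j).2
          have := @hX (e1 i).1 (e1 j).1
          simp
          tauto
        · exact iff_of_true (hadj _ (e2 j).2 _ (e1 i).2).symm (by simp)
        · exact iff_of_true (hadj _ (e2 i).2 _ (e1 j).2) (by simp)
        · have := hR _ (e2 i).2
          have := hR _ (e2 j).2
          have := @hX (e2 i).1 (e2 j).1
          simp
          tauto }
  exact ⟨Set.range φ, ⟨_, ⟨Sum.inl ⟨0, hd⟩, rfl⟩⟩, ⟨φ.isoInduceRange.symm⟩⟩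

lemma core_s6 (d : ℕ) (hd : 0 < d) : ∃ f : ℕ, ∀ (V : Type) [Fintype V] (G : SimpleGraph V),
      Bip G → f ≤ minDeg G →
      ∃ s : Set V, s.Nonempty ∧
        (Nonempty (G.induce s ≃g completeBipartiteGraph (Fin d) (Fin d)) ∨
          (d < minDeg (G.induce s) ∧ ¬ ContainsSub C4 (G.induce s))) := by
  obtain ⟨K, M, hU⟩ := unbal (4 * (d + 1)) d d
  obtain ⟨R, hR⟩ := sample_main K M
  refine ⟨2 * ⌈R⌉₊ + 1, fun V _ G hbip hdeg => ?_⟩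
  obtain ⟨X₀, hX₀⟩ := hbip
  unfold minDeg at hdeg
  have hV : Nonempty V := by
    by_contra hcon
    rw [not_nonempty_iff] at hcon
    rw [SimpleGraph.minDegree_of_subsingleton] at hdeg
    omega
  obtain ⟨W, -, hWn, l, hl, hEW, hWd⟩ := max_ratio G Finset.univ Finset.univ_nonempty
    (2 * ⌈R⌉₊ + 1 : ℕ) (by
      rw [mul_comm, ← nsmul_eq_mul]
      refine Finset.card_nsmul_le_sum _ _ _ fun v _ => ?_
      have h1 := hdeg.trans (G.minDegree_le_degree v)
      rw [← SimpleGraph.card_neighborFinset_eq_degree, SimpleGraph.neighborFinset_eq_filter] at h1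
      exact_mod_cast h1)
  have hRl : R ≤ l / 2 := by
    have := Nat.le_ceil R
    push_cast at hl
    linarith
  have hl0 : 0 < l := by
    have : (0:ℝ) < ((2 * ⌈R⌉₊ + 1 : ℕ) : ℝ) := by positivity
    linarith
  -- choose the larger side
  obtain ⟨X, hX, hbig⟩ : ∃ X : Set V, (∀ ⦃a b : V⦄, G.Adj a b → (a ∈ X ↔ b ∉ X)) ∧
      (W.filter (fun v => v ∉ X)).card ≤ (W.filter (fun v => v ∈ X)).card := by
    rcases le_total (W.filter (fun v => v ∉ X₀)).card (W.filter (fun v => v ∈ X₀)).card with h | h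
    · exact ⟨X₀, hX₀, h⟩
    · refine ⟨X₀ᶜ, fun a b hab => ?_, ?_⟩
      · have := hX₀ hab
        simp only [Set.mem_compl_iff]
        tauto
      · simpa using h
  set A := W.filter (fun v => v ∈ X) with hA
  set B := W.filter (fun v => v ∉ X) with hB
  set N : V → Finset V := fun v => W.filter (fun u => G.Adj v u) with hN
  have hcards : A.card + B.card = W.card := Finset.card_filter_add_card_filter_not _
  have hNB : ∀ a ∈ A, N a ∩ B = N a := by
    intro a ha
    rw [Finset.inter_eq_left]
    intro u hu
    simp only [hN, hA, hB, Finset.mem_filter] at hu ha ⊢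
    exact ⟨hu.1, (hX hu.2).1 ha.2⟩
  have hAn : A.Nonempty := by
    rw [← Finset.card_pos]
    have := hWn.card_pos
    omega
  obtain ⟨T, hTB, A1, hA1, hA1n, hA1K, hA1M⟩ := hR V V N A B (l / 2) hRl hAn
    (by
      intro a ha
      rw [hNB a ha]
      have := hWd a (Finset.mem_filter.1 ha).1
      linarith)
    (by
      rw [Finset.sum_congr rfl (fun a ha => by rw [hNB a ha])]
      have h1 : ∑ a ∈ A, ((N a).card : ℝ) ≤ ∑ a ∈ W, ((N a).card : ℝ) :=
        Finset.sum_le_sum_of_subset_of_nonneg (Finset.filter_subset _ _)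
          (fun _ _ _ => by positivity)
      have h2 : (W.card : ℝ) ≤ 2 * A.card := by
        have : W.card ≤ 2 * A.card := by omega
        exact_mod_cast this
      have h3 : ∑ a ∈ W, ((N a).card : ℝ) = l * W.card := hEW
      nlinarith)
    hbig
  by_cases hbc : ∀ S ⊆ T, S.card = d → (A1.filter (fun a => S ⊆ N a)).card < d
  swap
  · push Not at hbc
    obtain ⟨S, hST, hSc, hle⟩ := hbc
    obtain ⟨Q, hQ, hQc⟩ := Finset.exists_subset_card_eq hle
    obtain ⟨s, hs, hiso⟩ := biclique G X hX d hd S Q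
      (fun v hv => (Finset.mem_filter.1 (hTB (hST hv))).2)
      (fun v hv => (Finset.mem_filter.1 (hA1 (Finset.mem_filter.1 (hQ hv)).1)).2) hSc hQc
      (fun r hr v hv => by
        have := (Finset.mem_filter.1 (hQ hr)).2 hv
        exact (Finset.mem_filter.1 this).2)
    exact ⟨s, hs, Or.inl hiso⟩
  obtain ⟨A', hA', B', hB', hA'n, hA'D, hcod, hcard⟩ := hU V V N A1 T hA1n hA1K hA1M hbc
  have hA'X : ∀ v ∈ A', v ∈ X := fun v hv => (Finset.mem_filter.1 (hA1 (hA' hv))).2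
  have hB'X : ∀ v ∈ B', v ∉ X := fun v hv => (Finset.mem_filter.1 (hTB (hB' hv))).2
  have hB'W : B' ⊆ W := fun v hv => (Finset.mem_filter.1 (hTB (hB' hv))).1
  obtain ⟨W', hW', hW'n, l', hl', -, hW'd⟩ := max_ratio G (A' ∪ B')
    (hA'n.mono Finset.subset_union_left) (2 * (d + 1)) (by
      have h1 : ∑ v ∈ A', (((A' ∪ B').filter (fun u => G.Adj v u)).card : ℝ) ≤
          ∑ v ∈ A' ∪ B', (((A' ∪ B').filter (fun u => G.Adj v u)).card : ℝ) :=
        Finset.sum_le_sum_of_subset_of_nonneg Finset.subset_union_left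
          (fun _ _ _ => by positivity)
      refine le_trans ?_ h1
      have h2 : A'.card • (4 * ((d:ℝ) + 1)) ≤
          ∑ v ∈ A', (((A' ∪ B').filter (fun u => G.Adj v u)).card : ℝ) := by
        refine Finset.card_nsmul_le_sum _ _ _ fun v hv => ?_
        have h3 := hA'D v hv
        have h4 : (N v ∩ B').card ≤ ((A' ∪ B').filter (fun u => G.Adj v u)).card := by
          refine Finset.card_le_card fun u hu => ?_
          simp only [hN, Finset.mem_inter, Finset.mem_filter, Finset.mem_union] at hu ⊢
          exact ⟨Or.inr hu.2, hu.1.2⟩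
        rw [h3] at h4
        exact_mod_cast h4
      rw [nsmul_eq_mul] at h2
      refine le_trans ?_ h2
      have h5 : ((A' ∪ B').card : ℝ) ≤ 2 * A'.card := by
        have : (A' ∪ B').card ≤ 2 * A'.card := (Finset.card_union_le _ _).trans (by omega)
        exact_mod_cast this
      have : (0:ℝ) ≤ d := by positivity
      nlinarith)
  refine ⟨(W' : Set V), hW'n, Or.inr ⟨?_, ?_⟩⟩
  · refine minDeg_induce G W' hW'n (d + 1) (fun v hv => ?_) _ (fun _ => Finset.mem_coe)
    have h1 := hW'd v hv
    have : ((d + 1 : ℕ) : ℝ) ≤ (W'.filter (fun u => G.Adj v u)).card := by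
      push_cast
      linarith
    exact_mod_cast this
  · rintro ⟨g, hginj, hg⟩
    have key : ∀ x y u v : V, x ∈ W' → y ∈ W' → u ∈ W' → v ∈ W' → x ∈ X → x ≠ y → u ≠ v →
        G.Adj x u → G.Adj x v → G.Adj y u → G.Adj y v → False := by
      intro x y u v hx hy hu hv hxX hxy huv h1 h2 h3 h4
      have huX := (hX h1).1 hxX
      have hvX := (hX h2).1 hxX
      have hyX := (hX h3).2 huX
      have memA : ∀ z ∈ W', z ∈ X → z ∈ A' := fun z hz hzX => by
        rcases Finset.mem_union.1 (hW' hz) with h | h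
        · exact h
        · exact absurd hzX (hB'X z h)
      have memB : ∀ z ∈ W', z ∉ X → z ∈ B' := fun z hz hzX => by
        rcases Finset.mem_union.1 (hW' hz) with h | h
        · exact absurd (hA'X z h) hzX
        · exact h
      have huB := memB u hu huX
      have hvB := memB v hv hvX
      have h5 := hcod x (memA x hx hxX) y (memA y hy hyX) hxy
      have h6 : 1 < (N x ∩ N y ∩ B').card := by
        refine Finset.one_lt_card.2 ⟨u, ?_, v, ?_, huv⟩
        · simp only [hN, Finset.mem_inter, Finset.mem_filter]
          exact ⟨⟨⟨hB'W huB, h1⟩, ⟨hB'W huB, h3⟩⟩, huB⟩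
        · simp only [hN, Finset.mem_inter, Finset.mem_filter]
          exact ⟨⟨⟨hB'W hvB, h2⟩, ⟨hB'W hvB, h4⟩⟩, hvB⟩
      omega
    have adj : ∀ i j : Fin 4, C4.Adj i j → G.Adj (g i).1 (g j).1 := fun i j h => hg h
    have ne : ∀ i j : Fin 4, i ≠ j → (g i).1 ≠ (g j).1 := fun i j h h' =>
      h (hginj (Subtype.ext h'))
    have a01 := adj 0 1 (by simp [C4])
    have a12 := adj 1 2 (by simp [C4])
    have a23 := adj 2 3 (by simp [C4])
    have a30 := adj 3 0 (by simp [C4])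
    by_cases h0 : (g 0).1 ∈ X
    · exact key (g 0) (g 2) (g 1) (g 3) (g 0).2 (g 2).2 (g 1).2 (g 3).2 h0
        (ne 0 2 (by decide)) (ne 1 3 (by decide)) a01 a30.symm a12.symm a23
    · have h1 : (g 1).1 ∈ X := by
        have := hX a01
        tauto
      exact key (g 1) (g 3) (g 0) (g 2) (g 1).2 (g 3).2 (g 0).2 (g 2).2 h1
        (ne 1 3 (by decide)) (ne 0 2 (by decide)) a01.symm a12 a30 a23.symm

lemma core_zero (V : Type) [Fintype V] (G : SimpleGraph V) (h : 1 ≤ minDeg G) :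
    ∃ s : Set V, s.Nonempty ∧ 0 < minDeg (G.induce s) ∧ ¬ ContainsSub C4 (G.induce s) := by
  unfold minDeg at h
  have hV : Nonempty V := by
    by_contra hcon
    rw [not_nonempty_iff] at hcon
    rw [SimpleGraph.minDegree_of_subsingleton] at h
    omega
  obtain ⟨v⟩ := hV
  have h1 := h.trans (G.minDegree_le_degree v)
  obtain ⟨u, hu⟩ := (G.degree_pos_iff_exists_adj v).1 h1
  refine ⟨(({v, u} : Finset V) : Set V), ⟨v, by simp⟩, ?_, ?_⟩
  · refine minDeg_induce G {v, u} ⟨v, by simp⟩ 1 (fun x hx => ?_) _ (fun _ => Finset.mem_coe)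
    rw [Nat.one_le_iff_ne_zero, ← Nat.pos_iff_ne_zero, Finset.card_pos]
    rw [Finset.mem_insert, Finset.mem_singleton] at hx
    rcases hx with rfl | rfl
    · exact ⟨u, by simp [hu]⟩
    · exact ⟨v, by simp [hu.symm]⟩
  · rintro ⟨g, hg, -⟩
    have h2 := Fintype.card_le_of_injective g hg
    have h3 : Fintype.card (({v, u} : Finset V) : Set V) = ({v, u} : Finset V).card := by
      simp
    have := Finset.card_le_two (a := v) (b := u)
    simp only [Fintype.card_fin] at h2
    omega

/-- Every bipartite graph of huge minimum degree has a nonempty induced subgraph which is a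
biclique `K_{d,d}`, or `C₄`-free with minimum degree more than `d`. -/
theorem induced_biclique_or_C4free :
    ∃ f : ℕ → ℕ, ∀ d : ℕ, ∀ (V : Type) [Fintype V] (G : SimpleGraph V),
      Bip G → f d ≤ minDeg G →
      ∃ s : Set V, s.Nonempty ∧
        (Nonempty (G.induce s ≃g completeBipartiteGraph (Fin d) (Fin d)) ∨
          (d < minDeg (G.induce s) ∧ ¬ ContainsSub C4 (G.induce s))) := by
  have : ∀ d : ℕ, ∃ f : ℕ, ∀ (V : Type) [Fintype V] (G : SimpleGraph V),
      Bip G → f ≤ minDeg G →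
      ∃ s : Set V, s.Nonempty ∧
        (Nonempty (G.induce s ≃g completeBipartiteGraph (Fin d) (Fin d)) ∨
          (d < minDeg (G.induce s) ∧ ¬ ContainsSub C4 (G.induce s))) := by
    intro d
    rcases Nat.eq_zero_or_pos d with rfl | hd
    · refine ⟨1, fun V _ G _ h => ?_⟩
      obtain ⟨s, hs, h'⟩ := core_zero V G h
      exact ⟨s, hs, Or.inr h'⟩
    · exact core_s6 d hd
  choose f hf using this
  exact ⟨f, hf⟩
end
end
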